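/- Let U = [0,1] × [0,1] be the unit square and let Γ be a segment barrier for U whose union is contained in the square [−1/2, 3/2] × [−1/2, 3/2] (the square of side length 2 concentric and homothetic to U). Then the total length of Γ is at least 2 + 10⁻¹². -/

import Mathlib

open MeasureTheory Set

noncomputable section

/-- A point in the plane. -/
abbrev Pt : Type := EuclideanSpace ℝ (Fin 2)

/-- A line in ℝ² is a set {p + t • v : t ∈ ℝ} for some p, v with v ≠ 0. -/
def IsLine (l : Set Pt) : Prop :=
  ∃ p v : Pt, v ≠ 0 ∧ l = {q : Pt | ∃ t : ℝ, q = p + t • v}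

/-- Γ is a barrier (opaque set) for C if every line meeting C also meets Γ. -/
def IsBarrier (Γ C : Set Pt) : Prop :=
  ∀ l : Set Pt, IsLine l → (l ∩ C).Nonempty → (l ∩ Γ).Nonempty

/-- The closed unit square U = [0,1] × [0,1]. -/
def unitSquare : Set Pt := {p : Pt | p 0 ∈ Icc (0:ℝ) 1 ∧ p 1 ∈ Icc (0:ℝ) 1}

section Helpers

open ENNReal

/-- projection along direction `c`. -/
def fc (c : ℝ) (P : ℝ × ℝ) : ℝ := P.1 + c * P.2

/-- the line with parameters `(t, c)` is heavy at scale `2^-k`. -/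
def heavy (μ : Measure (ℝ × ℝ)) (t c : ℝ) (k : ℕ) : Prop :=
  ENNReal.ofReal (8 * (1/2) ^ k) ≤ μ {P | |fc c P - t| ≤ (1/2) ^ k}

/-- slope of the line through two points. -/
def ctime (P Q : ℝ × ℝ) : ℝ := (Q.1 - P.1) / (P.2 - Q.2)

def badAt (μ : Measure (ℝ × ℝ)) (P : ℝ × ℝ) (c : ℝ) : Prop :=
  ∃ k : ℕ, ENNReal.ofReal (8 * (1/2) ^ k) ≤ μ {P' | |fc c P' - fc c P| ≤ 2 * (1/2) ^ k}

def hitAt (BS : Set (ℝ × ℝ)) (P : ℝ × ℝ) (c : ℝ) : Prop := ∃ Q ∈ BS, fc c Q = fc c P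

lemma vitali_real {ι : Type*} (A : Set ι) (x : ι → ℝ) (r : ι → ℝ) (R : ℝ)
    (hr : ∀ a ∈ A, r a ≤ R) (hpos : ∀ a ∈ A, 0 < r a) :
    ∃ u ⊆ A, u.Countable ∧ (u.PairwiseDisjoint fun a => Metric.closedBall (x a) (r a)) ∧
      ∀ a ∈ A, ∃ b ∈ u, |x a - x b| ≤ 5 * r b := by
  obtain ⟨u, huA, hd, hc⟩ := Vitali.exists_disjoint_subfamily_covering_enlargement_closedBall
    A x r R hr 5 (by norm_num)
  refine ⟨u, huA, ?_, hd, ?_⟩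
  · apply hd.countable_of_nonempty_interior
    intro i hi
    refine ⟨x i, ?_⟩
    exact interior_mono Metric.ball_subset_closedBall
      (by rw [Metric.isOpen_ball.interior_eq]; exact Metric.mem_ball_self (hpos i (huA hi)))
  · intro a ha
    obtain ⟨b, hb, hs⟩ := hc a ha
    refine ⟨b, hb, ?_⟩
    have := hs (Metric.mem_closedBall_self (hpos a ha).le)
    rwa [Metric.mem_closedBall, Real.dist_eq] at this

lemma bad_mass (m : Measure ℝ) [IsFiniteMeasure m] (d : ℝ) (hd : 0 ≤ d)
    (h1 : ∀ E, MeasurableSet E → m E ≤ volume E + ENNReal.ofReal d) :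
    m {t | ∃ k : ℕ, ENNReal.ofReal (8 * (1/2) ^ k) ≤ m (Metric.closedBall t (2 * (1/2) ^ k))}
      ≤ ENNReal.ofReal (6 * d) := by
  set A := {t | ∃ k : ℕ, ENNReal.ofReal (8 * (1/2) ^ k) ≤ m (Metric.closedBall t (2 * (1/2) ^ k))}
    with hA
  have : ∀ t : ℝ, ∃ k : ℕ, t ∈ A →
      ENNReal.ofReal (8 * (1/2) ^ k) ≤ m (Metric.closedBall t (2 * (1/2) ^ k)) := by
    intro t
    by_cases ht : t ∈ A
    · obtain ⟨k, hk⟩ := ht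
      exact ⟨k, fun _ => hk⟩
    · exact ⟨0, fun h => absurd h ht⟩
  choose k hk using this
  obtain ⟨u, huA, hcu, hdis, hcov⟩ := vitali_real A (fun t => t) (fun t => 2 * (1/2 : ℝ) ^ (k t)) 2
    (fun a _ => by
      have : (1/2 : ℝ) ^ (k a) ≤ 1 := pow_le_one₀ (by norm_num) (by norm_num)
      linarith) (fun a _ => by positivity)
  set S : ℝ≥0∞ := ∑' t : u, ENNReal.ofReal ((1/2 : ℝ) ^ (k t)) with hS
  have e8 : ∑' t : u, ENNReal.ofReal (8 * (1/2 : ℝ) ^ (k t)) = 8 * S := by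
    rw [hS, ← ENNReal.tsum_mul_left]
    congr 1; ext t
    rw [ENNReal.ofReal_mul (by norm_num)]; norm_num
  have mU : MeasurableSet (⋃ t ∈ u, Metric.closedBall t (2 * (1/2 : ℝ) ^ (k t))) :=
    MeasurableSet.biUnion hcu (fun t _ => Metric.isClosed_closedBall.measurableSet)
  have l1 : 8 * S ≤ m (⋃ t ∈ u, Metric.closedBall t (2 * (1/2 : ℝ) ^ (k t))) := by
    rw [measure_biUnion hcu hdis (fun t _ => Metric.isClosed_closedBall.measurableSet), ← e8]
    exact ENNReal.tsum_le_tsum fun t => hk t (huA t.2)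
  have l2 : volume (⋃ t ∈ u, Metric.closedBall t (2 * (1/2 : ℝ) ^ (k t))) ≤ 4 * S := by
    refine (measure_biUnion_le _ hcu _).trans ?_
    rw [hS, ← ENNReal.tsum_mul_left]
    refine ENNReal.tsum_le_tsum fun t => ?_
    rw [Real.volume_closedBall, show (2 * (2 * (1/2 : ℝ) ^ (k t))) = 4 * (1/2 : ℝ) ^ (k t) by ring,
      ENNReal.ofReal_mul (by norm_num)]
    norm_num
  have l3 : 8 * S ≤ 4 * S + ENNReal.ofReal d := l1.trans ((h1 _ mU).trans (by gcongr))
  have hSfin : S ≠ ⊤ := by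
    intro h
    rw [h] at l1
    have : (8 : ℝ≥0∞) * ⊤ = ⊤ := by simp
    rw [this] at l1
    exact (measure_lt_top m _).ne (top_le_iff.1 l1)
  have l4 : 4 * S ≤ ENNReal.ofReal d := by
    have : 4 * S + 4 * S ≤ 4 * S + ENNReal.ofReal d := by
      rw [← add_mul]; norm_num; exact l3
    exact (ENNReal.add_le_add_iff_left (ENNReal.mul_ne_top (by norm_num) hSfin)).1 this
  have mV : MeasurableSet (⋃ t ∈ u, Metric.closedBall t (5 * (2 * (1/2 : ℝ) ^ (k t)))) :=
    MeasurableSet.biUnion hcu (fun t _ => Metric.isClosed_closedBall.measurableSet)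
  have sub : A ⊆ ⋃ t ∈ u, Metric.closedBall t (5 * (2 * (1/2 : ℝ) ^ (k t))) := by
    intro a ha
    obtain ⟨b, hb, h⟩ := hcov a ha
    refine mem_iUnion₂.2 ⟨b, hb, ?_⟩
    rw [Metric.mem_closedBall, Real.dist_eq]; exact h
  have l5 : volume (⋃ t ∈ u, Metric.closedBall t (5 * (2 * (1/2 : ℝ) ^ (k t)))) ≤ 20 * S := by
    refine (measure_biUnion_le _ hcu _).trans ?_
    rw [hS, ← ENNReal.tsum_mul_left]
    refine ENNReal.tsum_le_tsum fun t => ?_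
    rw [Real.volume_closedBall,
      show (2 * (5 * (2 * (1/2 : ℝ) ^ (k t)))) = 20 * (1/2 : ℝ) ^ (k t) by ring,
      ENNReal.ofReal_mul (by norm_num)]
    norm_num
  calc m A ≤ m (⋃ t ∈ u, Metric.closedBall t (5 * (2 * (1/2 : ℝ) ^ (k t)))) := measure_mono sub
    _ ≤ 20 * S + ENNReal.ofReal d := (h1 _ mV).trans (by gcongr)
    _ = 5 * (4 * S) + ENNReal.ofReal d := by rw [← mul_assoc]; norm_num
    _ ≤ 5 * ENNReal.ofReal d + ENNReal.ofReal d := by gcongr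
    _ = ENNReal.ofReal (6 * d) := by
      rw [show 6 * d = 5 * d + d by ring, ENNReal.ofReal_add (by positivity) hd,
        ENNReal.ofReal_mul (by norm_num)]
      norm_num

lemma fc_sub (c c' : ℝ) (P Q : ℝ × ℝ) :
    fc c P - fc c Q = fc c' P - fc c' Q + (c - c') * (P.2 - Q.2) := by
  simp only [fc]; ring

lemma fc_ctime (P Q : ℝ × ℝ) (h : P.2 - Q.2 ≠ 0) : fc (ctime P Q) P = fc (ctime P Q) Q := by
  simp only [fc, ctime]
  field_simp
  ring

/-- the pair `(P,Q)` spans a line on which `μ` is at least as heavy as `ν`. -/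
def dom (μ ν : Measure (ℝ × ℝ)) (P Q : ℝ × ℝ) : Prop :=
  ∀ k, heavy ν (fc (ctime P Q) P) (ctime P Q) k →
    ∃ j ≤ k, heavy μ (fc (ctime P Q) P) (ctime P Q) j

lemma half_section (μ ν : Measure (ℝ × ℝ)) (TS BS : Set (ℝ × ℝ))
    (hμ : μ TSᶜ = 0)
    (hT : ∀ P ∈ TS, ∀ Q ∈ TS, |P.2 - Q.2| ≤ 1/2)
    (hTB : ∀ P ∈ TS, ∀ Q ∈ BS, 1/2 ≤ |P.2 - Q.2| ∧ |P.2 - Q.2| ≤ 3/2)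
    (hsmall : ∀ k t c, |c| ≤ 2 → heavy μ t c k → (1/2 : ℝ) ^ k ≤ 1/15)
    (P : ℝ × ℝ) (hP : P ∈ TS) :
    ν {Q | Q ∈ BS ∧ |P.1 - Q.1| ≤ 1 ∧ dom μ ν P Q} ≤
      60 * volume {c : ℝ | |c| ≤ 5/2 ∧ (badAt μ P c ∨ hitAt BS P c)} := by
  set D := {c : ℝ | |c| ≤ 5/2 ∧ (badAt μ P c ∨ hitAt BS P c)} with hD
  set A := {Q | Q ∈ BS ∧ |P.1 - Q.1| ≤ 1 ∧ dom μ ν P Q} with hA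
  have hDfin : volume D ≠ ⊤ := by
    refine ne_top_of_le_ne_top (b := volume (Icc (-(5/2) : ℝ) (5/2))) (by simp) (measure_mono ?_)
    intro c hc
    exact abs_le.1 hc.1
  suffices H : ∀ ε : ℝ≥0∞, ε ≠ 0 → ν A ≤ 60 * (volume D + ε) by
    refine ENNReal.le_of_forall_pos_le_add ?_
    intro ε hε _
    have := H (ε / 60) (by simp [hε.ne'])
    refine this.trans (le_of_eq ?_)
    rw [mul_add, ENNReal.mul_div_cancel (by norm_num) (by norm_num)]
  intro ε hε
  obtain ⟨U, hDU, hUo, hUv⟩ := D.exists_isOpen_le_add volume hε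
  -- bounds on crossing times
  have hne : ∀ Q ∈ BS, P.2 - Q.2 ≠ 0 := by
    intro Q hQ h
    have := (hTB P hP Q hQ).1
    rw [h] at this; norm_num at this
  have hct : ∀ Q ∈ A, |ctime P Q| ≤ 2 := by
    intro Q hQ
    have h1 := (hTB P hP Q hQ.1).1
    rw [ctime, abs_div, div_le_iff₀ (by linarith), abs_sub_comm]
    have := hQ.2.1
    linarith
  have hrad : ∀ Q : ℝ × ℝ, ∃ ρ : ℝ, Q ∈ A → 0 < ρ ∧ ρ ≤ 1 ∧ Metric.closedBall (ctime P Q) ρ ⊆ U ∧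
      ν {Q' | |fc (ctime P Q) Q' - fc (ctime P Q) P| ≤ 15/2 * ρ} ≤ ENNReal.ofReal (120 * ρ) := by
    intro Q
    by_cases hQ : Q ∈ A
    swap
    · exact ⟨0, fun h => absurd h hQ⟩
    have hdom := hQ.2.2
    have hc2 := hct Q hQ
    have hcr := fc_ctime P Q (hne Q hQ.1)
    set c := ctime P Q with hc
    set t := fc c P with ht
    -- scale lemma
    have scale : ∀ R : ℝ, 0 < R → R ≤ 1 → (∀ i : ℕ, R ≤ (1/2 : ℝ) ^ i → ¬ heavy ν t c i) →
        ν {Q' | |fc c Q' - t| ≤ R} ≤ ENNReal.ofReal (16 * R) := by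
      intro R hR0 hR1 hno
      obtain ⟨i, hi1, hi2⟩ := exists_nat_pow_near_of_lt_one hR0 hR1
        (show (0:ℝ) < 1/2 by norm_num) (show (1/2:ℝ) < 1 by norm_num)
      have h := hno i hi2
      rw [heavy, not_le] at h
      refine (measure_mono ?_).trans (h.le.trans (ENNReal.ofReal_le_ofReal ?_))
      · intro Q' hQ'
        exact le_trans hQ' hi2
      · rw [pow_succ] at hi1
        linarith
    by_cases hex : ∃ j, heavy μ t c j
    · classical
      set j := Nat.find hex with hj
      have hjh : heavy μ t c j := Nat.find_spec hex
      have hjmin : ∀ i < j, ¬ heavy μ t c i := fun i hi => Nat.find_min hex hi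
      have hr := hsmall j t c hc2 hjh
      have hrpos : (0:ℝ) < (1/2) ^ j := by positivity
      set r : ℝ := (1/2) ^ j with hrdef
      refine ⟨2 * r, fun _ => ⟨by linarith, by linarith, ?_, ?_⟩⟩
      · refine subset_trans ?_ hDU
        intro c' hc'
        rw [Metric.mem_closedBall, Real.dist_eq] at hc'
        refine ⟨?_, Or.inl ⟨j, hjh.trans ?_⟩⟩
        · have := abs_add_le (c' - c) c
          rw [sub_add_cancel] at this
          linarith
        · have e : μ {P' | |fc c P' - t| ≤ r} = μ ({P' | |fc c P' - t| ≤ r} ∩ TS) := by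
            refine (measure_inter_conull ?_).symm
            exact hμ
          change μ {P' | |fc c P' - t| ≤ r} ≤ _
          rw [e]
          refine measure_mono ?_
          rintro P' ⟨h1, h2⟩
          change |fc c' P' - fc c' P| ≤ 2 * r
          rw [fc_sub c' c]
          have h3 := hT P' h2 P hP
          have h4 : |(c' - c) * (P'.2 - P.2)| ≤ r := by
            rw [abs_mul]
            calc |c' - c| * |P'.2 - P.2| ≤ (2 * r) * (1/2) := by gcongr
              _ = r := by ring
          have h5 : |fc c P' - fc c P| ≤ r := h1
          linarith [abs_add_le (fc c P' - fc c P) ((c' - c) * (P'.2 - P.2))]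
      · have := scale (15/2 * (2 * r)) (by linarith) (by linarith) (by
          intro i hi hh
          obtain ⟨j', hj', hh'⟩ := hdom i hh
          have hij : i < j := by
            by_contra hcon
            have : (1/2 : ℝ) ^ i ≤ (1/2) ^ j :=
              pow_le_pow_of_le_one (by norm_num) (by norm_num) (not_lt.1 hcon)
            linarith
          exact hjmin j' (lt_of_le_of_lt hj' hij) hh')
        refine this.trans (ENNReal.ofReal_le_ofReal ?_)
        linarith
    · push Not at hex
      have hnoν : ∀ i, ¬ heavy ν t c i := by
        intro i hi
        obtain ⟨j, _, hj⟩ := hdom i hi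
        exact hex j hj
      have hcU : c ∈ U := hDU ⟨by linarith, Or.inr ⟨Q, hQ.1, hcr.symm⟩⟩
      obtain ⟨e, he, hball⟩ := Metric.isOpen_iff.1 hUo c hcU
      refine ⟨min (e/2) (1/10), fun _ => ⟨by positivity, ?_, ?_, ?_⟩⟩
      · exact (min_le_right _ _).trans (by norm_num)
      · refine subset_trans ?_ hball
        refine Metric.closedBall_subset_ball ?_
        exact lt_of_le_of_lt (min_le_left _ _) (by linarith)
      · have h0 : 0 < min (e/2) (1/10) := by positivity
        have h1 : min (e/2) (1/10) ≤ 1/10 := min_le_right _ _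
        have := scale (15/2 * min (e/2) (1/10)) (by linarith) (by linarith) (fun i _ => hnoν i)
        refine this.trans (ENNReal.ofReal_le_ofReal ?_)
        linarith
  choose ρ hρ using hrad
  obtain ⟨u, huA, hcu, hdis, hcov⟩ := vitali_real A (fun Q => ctime P Q) ρ 1
    (fun a ha => (hρ a ha).2.1) (fun a ha => (hρ a ha).1)
  have sub : A ⊆ ⋃ Q ∈ u, {Q' | |fc (ctime P Q) Q' - fc (ctime P Q) P| ≤ 15/2 * ρ Q} := by
    intro Q' hQ'
    obtain ⟨Q, hQ, h⟩ := hcov Q' hQ'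
    refine mem_iUnion₂.2 ⟨Q, hQ, ?_⟩
    change |fc (ctime P Q) Q' - fc (ctime P Q) P| ≤ 15/2 * ρ Q
    rw [fc_sub (ctime P Q) (ctime P Q'), fc_ctime P Q' (hne Q' hQ'.1), sub_self, zero_add, abs_mul]
    have h1 := (hTB P hP Q' hQ'.1).2
    rw [abs_sub_comm] at h1 h
    calc _ ≤ (5 * ρ Q) * (3/2) := by
          gcongr
          exact (mul_nonneg (by norm_num) (hρ Q (huA hQ)).1.le)
      _ = 15/2 * ρ Q := by ring
  calc ν A ≤ ∑' Q : u, ν {Q' | |fc (ctime P Q) Q' - fc (ctime P Q) P| ≤ 15/2 * ρ Q} :=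
        (measure_mono sub).trans (measure_biUnion_le _ hcu _)
    _ ≤ ∑' Q : u, 60 * volume (Metric.closedBall (ctime P Q) (ρ Q)) := by
        refine ENNReal.tsum_le_tsum fun Q => (hρ Q (huA Q.2)).2.2.2.trans (le_of_eq ?_)
        rw [Real.volume_closedBall, show 120 * ρ Q = 60 * (2 * ρ Q) by ring,
          ENNReal.ofReal_mul (by norm_num)]
        norm_num
    _ = 60 * volume (⋃ Q ∈ u, Metric.closedBall (ctime P Q) (ρ Q)) := by
        rw [ENNReal.tsum_mul_left, measure_biUnion hcu hdis
          (fun t _ => Metric.isClosed_closedBall.measurableSet)]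
    _ ≤ 60 * volume U := by
        gcongr
        exact iUnion₂_subset fun Q hQ => (hρ Q (huA hQ)).2.2.1
    _ ≤ 60 * (volume D + ε) := by gcongr


lemma measurable_fc : Measurable fun z : (ℝ × ℝ) × ℝ => fc z.2 z.1 := by
  unfold fc; fun_prop

lemma measurable_fc' (c : ℝ) : Measurable (fc c) := by
  unfold fc; fun_prop

lemma measurable_ctime : Measurable fun z : (ℝ × ℝ) × (ℝ × ℝ) => ctime z.1 z.2 := by
  unfold ctime; fun_prop

lemma measurableSet_badAt (μ : Measure (ℝ × ℝ)) [IsFiniteMeasure μ] :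
    MeasurableSet {z : (ℝ × ℝ) × ℝ | badAt μ z.1 z.2} := by
  have : {z : (ℝ × ℝ) × ℝ | badAt μ z.1 z.2} = ⋃ k : ℕ, {z : (ℝ × ℝ) × ℝ |
      ENNReal.ofReal (8 * (1/2) ^ k) ≤
        μ {P' | |fc z.2 P' - fc z.2 z.1| ≤ 2 * (1/2) ^ k}} := by
    ext z; simp [badAt]
  rw [this]
  refine MeasurableSet.iUnion fun k => ?_
  refine measurableSet_le measurable_const ?_
  have hs : MeasurableSet {w : ((ℝ × ℝ) × ℝ) × (ℝ × ℝ) |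
      |fc w.1.2 w.2 - fc w.1.2 w.1.1| ≤ 2 * (1/2) ^ k} := by
    refine measurableSet_le ?_ measurable_const
    unfold fc; fun_prop
  exact measurable_measure_prodMk_left hs

lemma measurableSet_heavy (μ : Measure (ℝ × ℝ)) [IsFiniteMeasure μ] (k : ℕ) :
    MeasurableSet {z : ℝ × ℝ | heavy μ z.1 z.2 k} := by
  refine measurableSet_le measurable_const ?_
  have hs : MeasurableSet {w : (ℝ × ℝ) × (ℝ × ℝ) |
      |fc w.1.2 w.2 - w.1.1| ≤ (1/2) ^ k} := by
    refine measurableSet_le ?_ measurable_const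
    unfold fc; fun_prop
  exact measurable_measure_prodMk_left hs

lemma measurableSet_dom (μ ν : Measure (ℝ × ℝ)) [IsFiniteMeasure μ] [IsFiniteMeasure ν] :
    MeasurableSet {z : (ℝ × ℝ) × (ℝ × ℝ) | dom μ ν z.1 z.2} := by
  have hm : Measurable fun z : (ℝ × ℝ) × (ℝ × ℝ) => (fc (ctime z.1 z.2) z.1, ctime z.1 z.2) := by
    refine Measurable.prodMk ?_ measurable_ctime
    exact measurable_fc.comp (measurable_fst.prodMk measurable_ctime)
  have e : {z : (ℝ × ℝ) × (ℝ × ℝ) | dom μ ν z.1 z.2} = ⋂ k : ℕ,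
      ({z | heavy ν (fc (ctime z.1 z.2) z.1) (ctime z.1 z.2) k}ᶜ ∪
        ⋃ j : ℕ, ⋃ _ : j ≤ k, {z | heavy μ (fc (ctime z.1 z.2) z.1) (ctime z.1 z.2) j}) := by
    ext z
    simp only [dom, mem_ofPred_eq, mem_iInter, mem_union, mem_compl_iff, mem_iUnion, exists_prop]
    refine forall_congr' fun k => ?_
    tauto
  rw [e]
  refine MeasurableSet.iInter fun k => ?_
  refine ((hm (measurableSet_heavy ν k)).compl).union ?_
  exact MeasurableSet.iUnion fun j => MeasurableSet.iUnion fun _ => hm (measurableSet_heavy μ j)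

lemma half_lemma (μ ν : Measure (ℝ × ℝ)) [IsFiniteMeasure μ] [IsFiniteMeasure ν]
    (TS BS : Set (ℝ × ℝ)) (mT : MeasurableSet TS) (mB : MeasurableSet BS)
    (mH : MeasurableSet {z : (ℝ × ℝ) × ℝ | hitAt BS z.1 z.2})
    (hμ : μ TSᶜ = 0)
    (hT : ∀ P ∈ TS, ∀ Q ∈ TS, |P.2 - Q.2| ≤ 1/2)
    (hTB : ∀ P ∈ TS, ∀ Q ∈ BS, 1/2 ≤ |P.2 - Q.2| ∧ |P.2 - Q.2| ≤ 3/2)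
    (d : ℝ) (hd : 0 ≤ d) (hd1 : d ≤ 1/10)
    (h1 : ∀ c : ℝ, |c| ≤ 5/2 → ∀ E, MeasurableSet E →
      μ (fc c ⁻¹' E) ≤ volume E + ENNReal.ofReal d)
    (h2 : ∀ c : ℝ, |c| ≤ 5/2 → μ {P | P ∈ TS ∧ hitAt BS P c} ≤ ENNReal.ofReal d) :
    (μ.prod ν) {z | z.1 ∈ TS ∧ z.2 ∈ BS ∧ |z.1.1 - z.2.1| ≤ 1 ∧ dom μ ν z.1 z.2} ≤
      ENNReal.ofReal (2100 * d) := by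
  have hsmall : ∀ k t c, |c| ≤ 2 → heavy μ t c k → (1/2 : ℝ) ^ k ≤ 1/15 := by
    intro k t c hc hh
    have hE := h1 c (by linarith) (Metric.closedBall t ((1/2) ^ k))
      Metric.isClosed_closedBall.measurableSet
    have e : fc c ⁻¹' (Metric.closedBall t ((1/2) ^ k)) = {P | |fc c P - t| ≤ (1/2) ^ k} := by
      ext P; simp [Real.dist_eq]
    have hp : (0:ℝ) < (1/2) ^ k := by positivity
    rw [e, Real.volume_closedBall, ← ENNReal.ofReal_add (by positivity) hd] at hE
    have := hh.trans hE
    rw [ENNReal.ofReal_le_ofReal_iff (by positivity)] at this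
    linarith
  have mS : MeasurableSet {z : (ℝ × ℝ) × (ℝ × ℝ) |
      z.1 ∈ TS ∧ z.2 ∈ BS ∧ |z.1.1 - z.2.1| ≤ 1 ∧ dom μ ν z.1 z.2} := by
    have mx : MeasurableSet {z : (ℝ × ℝ) × (ℝ × ℝ) | |z.1.1 - z.2.1| ≤ 1} :=
      measurableSet_le (by fun_prop) measurable_const
    exact (measurable_fst mT).inter ((measurable_snd mB).inter (mx.inter
      (measurableSet_dom μ ν)))
  set D : Set ((ℝ × ℝ) × ℝ) := {z | z.1 ∈ TS ∧ |z.2| ≤ 5/2 ∧ (badAt μ z.1 z.2 ∨ hitAt BS z.1 z.2)}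
    with hD
  have mD : MeasurableSet D := by
    have mx : MeasurableSet {z : (ℝ × ℝ) × ℝ | |z.2| ≤ 5/2} :=
      measurableSet_le (by fun_prop) measurable_const
    exact (measurable_fst mT).inter (mx.inter ((measurableSet_badAt μ).union mH))
  have step1 : (μ.prod ν) {z | z.1 ∈ TS ∧ z.2 ∈ BS ∧ |z.1.1 - z.2.1| ≤ 1 ∧ dom μ ν z.1 z.2}
      ≤ 60 * (μ.prod volume) D := by
    rw [Measure.prod_apply mS, Measure.prod_apply mD, ← lintegral_const_mul _
      (measurable_measure_prodMk_left mD)]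
    refine lintegral_mono fun P => ?_
    by_cases hP : P ∈ TS
    · have := half_section μ ν TS BS hμ hT hTB hsmall P hP
      convert this using 2
      · ext Q; simp [hP]
      · congr 1; ext c; simp [hD, hP]
    · have : Prod.mk P ⁻¹' {z : (ℝ × ℝ) × (ℝ × ℝ) |
          z.1 ∈ TS ∧ z.2 ∈ BS ∧ |z.1.1 - z.2.1| ≤ 1 ∧ dom μ ν z.1 z.2} = ∅ := by
        ext Q; simp [hP]
      simp only [this, measure_empty]
      exact bot_le
  have step2 : (μ.prod volume) D ≤ ENNReal.ofReal (35 * d) := by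
    rw [Measure.prod_apply_symm mD]
    have hb : ∀ c : ℝ, μ ((fun P => (P, c)) ⁻¹' D) ≤
        (Icc (-(5/2) : ℝ) (5/2)).indicator (fun _ => ENNReal.ofReal (7 * d)) c := by
      intro c
      by_cases hc : c ∈ Icc (-(5/2) : ℝ) (5/2)
      · rw [indicator_of_mem hc]
        have hc' : |c| ≤ 5/2 := abs_le.2 hc
        have b1 : μ {P | badAt μ P c} ≤ ENNReal.ofReal (6 * d) := by
          have hmap : ∀ E, MeasurableSet E → μ.map (fc c) E ≤ volume E + ENNReal.ofReal d := by
            intro E hE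
            rw [Measure.map_apply (measurable_fc' c) hE]
            exact h1 c hc' E hE
          have := bad_mass (μ.map (fc c)) d hd hmap
          refine le_trans ?_ this
          refine le_trans (measure_mono ?_) (Measure.le_map_apply (measurable_fc' c).aemeasurable _)
          rintro P ⟨k, hk⟩
          refine ⟨k, ?_⟩
          rw [Measure.map_apply (measurable_fc' c) Metric.isClosed_closedBall.measurableSet]
          refine hk.trans (le_of_eq ?_)
          congr 1
        calc μ ((fun P => (P, c)) ⁻¹' D)
            ≤ μ ({P | badAt μ P c} ∪ {P | P ∈ TS ∧ hitAt BS P c}) := by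
              refine measure_mono ?_
              rintro P ⟨h, _, h' | h'⟩
              · exact Or.inl h'
              · exact Or.inr ⟨h, h'⟩
          _ ≤ ENNReal.ofReal (6 * d) + ENNReal.ofReal d :=
              (measure_union_le _ _).trans (add_le_add b1 (h2 c hc'))
          _ = ENNReal.ofReal (7 * d) := by
              rw [← ENNReal.ofReal_add (by positivity) hd]; congr 1; ring
      · rw [indicator_of_notMem hc]
        have : (fun P => (P, c)) ⁻¹' D = ∅ := by
          ext P
          simp only [hD, mem_preimage, mem_ofPred_eq, mem_empty_iff_false, iff_false]
          rintro ⟨_, h, _⟩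
          exact hc (abs_le.1 h)
        simp [this]
    refine (lintegral_mono hb).trans ?_
    rw [lintegral_indicator measurableSet_Icc, lintegral_const, Measure.restrict_apply_univ,
      Real.volume_Icc, ← ENNReal.ofReal_mul (by positivity)]
    refine ENNReal.ofReal_le_ofReal ?_
    linarith
  refine step1.trans ?_
  calc 60 * (μ.prod volume) D ≤ 60 * ENNReal.ofReal (35 * d) := by gcongr
    _ = ENNReal.ofReal (2100 * d) := by
      rw [show 2100 * d = 60 * (35 * d) by ring, ENNReal.ofReal_mul (p := 60) (by norm_num)]
      norm_num

lemma ctime_symm (P Q : ℝ × ℝ) : ctime Q P = ctime P Q := by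
  unfold ctime
  rw [← neg_sub P.2 Q.2, ← neg_sub Q.1 P.1, neg_div_neg_eq]

lemma dyn_lemma (μ ν : Measure (ℝ × ℝ)) [IsFiniteMeasure μ] [IsFiniteMeasure ν]
    (TS BS : Set (ℝ × ℝ)) (mT : MeasurableSet TS) (mB : MeasurableSet BS)
    (mHB : MeasurableSet {z : (ℝ × ℝ) × ℝ | hitAt BS z.1 z.2})
    (mHT : MeasurableSet {z : (ℝ × ℝ) × ℝ | hitAt TS z.1 z.2})
    (hμ : μ TSᶜ = 0) (hν : ν BSᶜ = 0)
    (hT : ∀ P ∈ TS, P.2 ∈ Icc (1/4 : ℝ) (3/4))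
    (hB : ∀ P ∈ BS, P.2 ∈ Icc (-(3/4) : ℝ) (-(1/4)))
    (d : ℝ) (hd : 0 ≤ d) (hd1 : d ≤ 1/10)
    (h1μ : ∀ c : ℝ, |c| ≤ 5/2 → ∀ E, MeasurableSet E →
      μ (fc c ⁻¹' E) ≤ volume E + ENNReal.ofReal d)
    (h1ν : ∀ c : ℝ, |c| ≤ 5/2 → ∀ E, MeasurableSet E →
      ν (fc c ⁻¹' E) ≤ volume E + ENNReal.ofReal d)
    (h2μ : ∀ c : ℝ, |c| ≤ 5/2 → μ {P | P ∈ TS ∧ hitAt BS P c} ≤ ENNReal.ofReal d)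
    (h2ν : ∀ c : ℝ, |c| ≤ 5/2 → ν {P | P ∈ BS ∧ hitAt TS P c} ≤ ENNReal.ofReal d) :
    (μ.prod ν) {z | z.1 ∈ TS ∧ z.2 ∈ BS ∧ |z.1.1 - z.2.1| ≤ 1} ≤ ENNReal.ofReal (4200 * d) := by
  have A := half_lemma μ ν TS BS mT mB mHB hμ
    (fun P hP Q hQ => by
      have := hT P hP; have := hT Q hQ; simp only [mem_Icc] at *
      rw [abs_le]; constructor <;> linarith)
    (fun P hP Q hQ => by
      have := hT P hP; have := hB Q hQ; simp only [mem_Icc] at *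
      rw [abs_of_nonneg (by linarith)]; constructor <;> linarith) d hd hd1 h1μ h2μ
  have B := half_lemma ν μ BS TS mB mT mHT hν
    (fun P hP Q hQ => by
      have := hB P hP; have := hB Q hQ; simp only [mem_Icc] at *
      rw [abs_le]; constructor <;> linarith)
    (fun P hP Q hQ => by
      have := hB P hP; have := hT Q hQ; simp only [mem_Icc] at *
      rw [abs_of_nonpos (by linarith)]; constructor <;> linarith) d hd hd1 h1ν h2ν
  have mS : MeasurableSet {z : (ℝ × ℝ) × (ℝ × ℝ) |
      z.1 ∈ BS ∧ z.2 ∈ TS ∧ |z.1.1 - z.2.1| ≤ 1 ∧ dom ν μ z.1 z.2} := by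
    have mx : MeasurableSet {z : (ℝ × ℝ) × (ℝ × ℝ) | |z.1.1 - z.2.1| ≤ 1} :=
      measurableSet_le (by fun_prop) measurable_const
    exact (measurable_fst mB).inter ((measurable_snd mT).inter (mx.inter
      (measurableSet_dom ν μ)))
  have B' : (μ.prod ν) (Prod.swap ⁻¹' {z : (ℝ × ℝ) × (ℝ × ℝ) |
      z.1 ∈ BS ∧ z.2 ∈ TS ∧ |z.1.1 - z.2.1| ≤ 1 ∧ dom ν μ z.1 z.2}) ≤
      ENNReal.ofReal (2100 * d) := by
    rw [← Measure.map_apply measurable_swap mS, Measure.prod_swap]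
    exact B
  rw [show 4200 * d = 2100 * d + 2100 * d by ring, ENNReal.ofReal_add (by positivity) (by positivity)]
  refine le_trans (measure_mono ?_) ((measure_union_le _ _).trans (add_le_add A B'))
  rintro ⟨P, Q⟩ ⟨hP, hQ, hx⟩
  by_cases hdm : dom μ ν P Q
  · exact Or.inl ⟨hP, hQ, hx, hdm⟩
  · right
    refine ⟨hQ, hP, ?_, ?_⟩
    · change |Q.1 - P.1| ≤ 1
      rw [abs_sub_comm]; exact hx
    · change dom ν μ Q P
      have hne : P.2 - Q.2 ≠ 0 := by
        have := hT P hP; have := hB Q hQ; simp only [mem_Icc] at *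
        intro h; linarith
      unfold dom at hdm ⊢
      push Not at hdm
      obtain ⟨k, hk, hno⟩ := hdm
      rw [ctime_symm P Q, ← fc_ctime P Q hne]
      intro j hj
      refine ⟨k, ?_, hk⟩
      by_contra hcon
      exact hno j (not_le.1 hcon).le hj


/-- measure of the parameters of a segment whose projection lies in `A`. -/
def vv (α β : ℝ) (A : Set ℝ) : ℝ := volume.real (Icc (0:ℝ) 1 ∩ {u | α + u * β ∈ A})

open scoped Pointwise in
lemma cover_image (α β : ℝ) (A : Set ℝ) :
    volume (A ∩ {t | ∃ u ∈ Icc (0:ℝ) 1, α + u * β = t}) ≤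
      ENNReal.ofReal |β| * volume (Icc (0:ℝ) 1 ∩ {u | α + u * β ∈ A}) := by
  set V := Icc (0:ℝ) 1 ∩ {u | α + u * β ∈ A} with hV
  have h1 : A ∩ {t | ∃ u ∈ Icc (0:ℝ) 1, α + u * β = t} ⊆ (fun t => α + t) '' (β • V) := by
    rintro t ⟨ht, u, hu, rfl⟩
    refine ⟨β • u, Set.smul_mem_smul_set ⟨hu, ht⟩, ?_⟩
    simp [mul_comm]
  refine (measure_mono h1).trans ?_
  rw [Set.image_add_left, measure_preimage_add, Measure.addHaar_smul]
  simp

lemma cover_enn (α β : ℕ → ℝ) (S : Set ℕ) (A : Set ℝ)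
    (hA : ∀ t ∈ A, ∃ i ∈ S, ∃ u ∈ Icc (0:ℝ) 1, α i + u * β i = t) :
    volume A ≤ ∑' i, S.indicator (fun i => ENNReal.ofReal |β i| *
      volume (Icc (0:ℝ) 1 ∩ {u | α i + u * β i ∈ A})) i := by
  have h1 : A ⊆ ⋃ i, (⋃ _ : i ∈ S, A ∩ {t | ∃ u ∈ Icc (0:ℝ) 1, α i + u * β i = t}) := by
    intro t ht
    obtain ⟨i, hi, u, hu, h⟩ := hA t ht
    exact mem_iUnion.2 ⟨i, mem_iUnion.2 ⟨hi, ht, u, hu, h⟩⟩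
  refine (measure_mono h1).trans ((measure_iUnion_le _).trans (ENNReal.tsum_le_tsum fun i => ?_))
  by_cases hi : i ∈ S
  · simp only [hi, iUnion_true, indicator_of_mem]
    exact cover_image _ _ _
  · simp [hi]

lemma vv_nonneg (α β : ℝ) (A : Set ℝ) : 0 ≤ vv α β A := measureReal_nonneg

lemma vol_fin (V : Set ℝ) : volume (Icc (0:ℝ) 1 ∩ V) ≠ ⊤ :=
  ne_top_of_le_ne_top (b := volume (Icc (0:ℝ) 1)) (by simp) (measure_mono inter_subset_left)

lemma vv_le_one (α β : ℝ) (A : Set ℝ) : vv α β A ≤ 1 := by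
  have : vv α β A ≤ volume.real (Icc (0:ℝ) 1) := measureReal_mono inter_subset_left (by simp)
  simpa using this

lemma vv_mono (α β : ℝ) {A B : Set ℝ} (h : A ⊆ B) : vv α β A ≤ vv α β B :=
  measureReal_mono (inter_subset_inter_right _ fun _ hu => h hu) (vol_fin _)

lemma measurable_aff (α β : ℝ) : Measurable fun u : ℝ => α + u * β := by fun_prop

lemma vv_compl (α β : ℝ) (A : Set ℝ) (hA : MeasurableSet A) : vv α β A + vv α β Aᶜ = 1 := by
  have h := measureReal_inter_add_sdiff (μ := volume) (s := Icc (0:ℝ) 1)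
    (measurable_aff α β hA) (by simp)
  have e : Icc (0:ℝ) 1 \ ((fun u : ℝ => α + u * β) ⁻¹' A) = Icc (0:ℝ) 1 ∩ {u | α + u * β ∈ Aᶜ} := by
    ext u; simp
  rw [e] at h
  refine h.trans ?_
  simp

lemma summable_vv {α β w : ℕ → ℝ} (hs : Summable w) (hw : ∀ i, 0 ≤ w i) (A : Set ℝ) :
    Summable fun i => w i * vv (α i) (β i) A :=
  Summable.of_nonneg_of_le (fun i => mul_nonneg (hw i) (vv_nonneg _ _ _))
    (fun i => mul_le_of_le_one_right (hw i) (vv_le_one _ _ _)) hs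

lemma cover_real (α β : ℕ → ℝ) (hs : Summable fun i => |β i|) (S : Set ℕ) (A : Set ℝ)
    (hA : ∀ t ∈ A, ∃ i ∈ S, ∃ u ∈ Icc (0:ℝ) 1, α i + u * β i = t) :
    volume.real A ≤ ∑' i, S.indicator (fun i => |β i| * vv (α i) (β i) A) i := by
  have hsum : Summable (S.indicator (fun i => |β i| * vv (α i) (β i) A)) :=
    (summable_vv hs (fun i => abs_nonneg _) A).indicator S
  have hnn : ∀ i, 0 ≤ S.indicator (fun i => |β i| * vv (α i) (β i) A) i := fun i =>
    indicator_nonneg (fun i _ => mul_nonneg (abs_nonneg _) (vv_nonneg _ _ _)) i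
  have h := cover_enn α β S A hA
  refine ENNReal.toReal_le_of_le_ofReal (tsum_nonneg hnn) (h.trans (le_of_eq ?_))
  rw [ENNReal.ofReal_tsum_of_nonneg hnn hsum]
  congr 1; ext i
  by_cases hi : i ∈ S
  · simp only [hi, indicator_of_mem, vv, measureReal_def]
    rw [ENNReal.ofReal_mul (abs_nonneg _), ENNReal.ofReal_toReal (vol_fin _)]
  · simp [hi]

lemma moment (α β : ℕ → ℝ) (hs : Summable fun i => |β i|) (R h K : ℝ) (hh : 0 ≤ h) (hR : h ≤ R)
    (hb : ∀ i, ∀ u ∈ Icc (0:ℝ) 1, |α i + u * β i| ≤ R)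
    (hc : ∀ t, |t| ≤ h → ∃ i, ∃ u ∈ Icc (0:ℝ) 1, α i + u * β i = t)
    (φ : ℝ → ℝ) (hφ : Continuous φ) (hK : ∀ t, |t| ≤ R → φ t ≤ K) :
    (Summable fun i => |β i| * ∫ u in (0:ℝ)..1, φ (α i + u * β i)) ∧
    ∑' i, |β i| * ∫ u in (0:ℝ)..1, φ (α i + u * β i) ≤
      (∫ t in (-h)..h, φ t) + K * (∑' i, |β i| - 2 * h) := by
  have hR0 : 0 ≤ R := hh.trans hR
  obtain ⟨C, hC⟩ : ∃ C, ∀ t ∈ Icc (-R) R, ‖φ t‖ ≤ C :=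
    isCompact_Icc.exists_bound_of_continuousOn hφ.continuousOn
  have hint : ∀ i, |∫ u in (0:ℝ)..1, φ (α i + u * β i)| ≤ C := by
    intro i
    have := intervalIntegral.norm_integral_le_of_norm_le_const (a := (0:ℝ)) (b := 1) (C := C)
      (f := fun u => φ (α i + u * β i)) (by
        intro u hu
        rw [uIoc_of_le zero_le_one] at hu
        exact hC _ (abs_le.1 (hb i u ⟨hu.1.le, hu.2⟩)))
    simpa using this
  have hsum : Summable fun i => |β i| * ∫ u in (0:ℝ)..1, φ (α i + u * β i) := by
    refine Summable.of_norm_bounded (hs.mul_right C) fun i => ?_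
    rw [Real.norm_eq_abs, abs_mul, abs_abs]
    exact mul_le_mul_of_nonneg_left (hint i) (abs_nonneg _)
  refine ⟨hsum, ?_⟩
  -- domination of measures
  set M : Measure ℝ := Measure.sum fun i => ENNReal.ofReal |β i| •
    (volume.restrict (Icc (0:ℝ) 1)).map (fun u => α i + u * β i) with hM
  have hdom : volume.restrict (Icc (-h) h) ≤ M := by
    refine Measure.le_iff.2 fun A hA => ?_
    rw [Measure.restrict_apply hA, hM, Measure.sum_apply _ hA]
    refine (cover_enn α β univ (A ∩ Icc (-h) h) (fun t ht => ?_)).trans ?_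
    · obtain ⟨i, hi⟩ := hc t (abs_le.2 ht.2)
      exact ⟨i, mem_univ _, hi⟩
    · refine ENNReal.tsum_le_tsum fun i => ?_
      rw [indicator_of_mem (mem_univ i), Measure.smul_apply, smul_eq_mul,
        Measure.map_apply (measurable_aff _ _) hA, Measure.restrict_apply (measurable_aff _ _ hA)]
      refine mul_le_mul_right (measure_mono fun u hu => ?_) _
      exact ⟨hu.2.1, hu.1⟩
  have hnn : ∀ i, 0 ≤ |β i| * ∫ u in (0:ℝ)..1, (K - φ (α i + u * β i)) := fun i => by
    refine mul_nonneg (abs_nonneg _) (intervalIntegral.integral_nonneg zero_le_one fun u hu => ?_)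
    linarith [hK _ (hb i u hu)]
  have hi : ∀ i, ∫ u in (0:ℝ)..1, (K - φ (α i + u * β i)) =
      K - ∫ u in (0:ℝ)..1, φ (α i + u * β i) := by
    intro i
    rw [intervalIntegral.integral_sub]
    · simp
    · simp
    · exact Continuous.intervalIntegrable (by fun_prop) _ _
  have hsum2 : Summable fun i => |β i| * ∫ u in (0:ℝ)..1, (K - φ (α i + u * β i)) := by
    simp only [hi, mul_sub]
    exact (hs.mul_right K).sub hsum
  have h1 : ENNReal.ofReal (∫ t in (-h)..h, (K - φ t)) ≤
      ENNReal.ofReal (∑' i, |β i| * ∫ u in (0:ℝ)..1, (K - φ (α i + u * β i))) := by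
    rw [ENNReal.ofReal_tsum_of_nonneg hnn hsum2]
    have hm : Measurable fun t => ENNReal.ofReal (K - φ t) := by fun_prop
    have hL := lintegral_mono' hdom (le_refl fun t => ENNReal.ofReal (K - φ t))
    rw [hM, lintegral_sum_measure] at hL
    refine le_trans (le_of_eq ?_) (hL.trans (le_of_eq ?_))
    · rw [intervalIntegral.integral_of_le (by linarith), ← integral_Icc_eq_integral_Ioc,
        ofReal_integral_eq_lintegral_ofReal]
      · exact (Continuous.continuousOn (by fun_prop)).integrableOn_Icc
      · refine (ae_restrict_iff' measurableSet_Icc).2 (Filter.Eventually.of_forall fun t ht => ?_)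
        have := hK t ((abs_le.2 ht).trans hR)
        simp only [Pi.zero_apply]; linarith
    · congr 1; ext i
      rw [lintegral_smul_measure, lintegral_map hm (measurable_aff _ _), smul_eq_mul,
        ENNReal.ofReal_mul (abs_nonneg _), intervalIntegral.integral_of_le zero_le_one,
        ← integral_Icc_eq_integral_Ioc, ofReal_integral_eq_lintegral_ofReal]
      · exact (Continuous.continuousOn (by fun_prop)).integrableOn_Icc
      · refine (ae_restrict_iff' measurableSet_Icc).2 (Filter.Eventually.of_forall fun u hu => ?_)
        have := hK _ (hb i u hu)
        simp only [Pi.zero_apply]; linarith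
  rw [ENNReal.ofReal_le_ofReal_iff (tsum_nonneg hnn)] at h1
  rw [intervalIntegral.integral_sub (by simp) (hφ.intervalIntegrable _ _)] at h1
  simp only [hi, mul_sub] at h1
  rw [(hs.mul_right K).tsum_sub hsum, tsum_mul_right] at h1
  simp only [intervalIntegral.integral_const, smul_eq_mul] at h1
  linarith


/-- a segment configuration in the box `[-1,1]^2` blocking all lines through `[-1/2,1/2]^2`. -/
structure Cfg (ax ay dx dy : ℕ → ℝ) : Prop where
  boxx : ∀ i, ∀ u ∈ Icc (0:ℝ) 1, |ax i + u * dx i| ≤ 1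
  boxy : ∀ i, ∀ u ∈ Icc (0:ℝ) 1, |ay i + u * dy i| ≤ 1
  cov : ∀ p q t : ℝ, (p ≠ 0 ∨ q ≠ 0) → |t| ≤ (|p| + |q|) / 2 →
    ∃ i, ∃ u ∈ Icc (0:ℝ) 1, (p * ax i + q * ay i) + u * (p * dx i + q * dy i) = t
  sx : Summable fun i => |dx i|
  sy : Summable fun i => |dy i|

namespace Cfg

variable {ax ay dx dy : ℕ → ℝ}

lemma sb (C : Cfg ax ay dx dy) (p q : ℝ) : Summable fun i => |p * dx i + q * dy i| := by
  refine Summable.of_nonneg_of_le (fun i => abs_nonneg _) (fun i => ?_)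
    ((C.sx.mul_left |p|).add (C.sy.mul_left |q|))
  rw [← abs_mul, ← abs_mul]
  exact abs_add_le _ _

lemma length_ge (C : Cfg ax ay dx dy) (p q : ℝ) (hpq : p ≠ 0 ∨ q ≠ 0) :
    |p| + |q| ≤ ∑' i, |p * dx i + q * dy i| := by
  have h := cover_real (fun i => p * ax i + q * ay i) (fun i => p * dx i + q * dy i) (C.sb p q)
    univ (Icc (-((|p| + |q|) / 2)) ((|p| + |q|) / 2)) (fun t ht => by
      obtain ⟨i, hi⟩ := C.cov p q t hpq (abs_le.2 ht)
      exact ⟨i, mem_univ _, hi⟩)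
  have hp : 0 ≤ |p| + |q| := by positivity
  rw [Real.volume_real_Icc_of_le (by linarith)] at h
  have h2 : ∑' i, (univ : Set ℕ).indicator (fun i => |p * dx i + q * dy i| *
      vv (p * ax i + q * ay i) (p * dx i + q * dy i)
        (Icc (-((|p| + |q|) / 2)) ((|p| + |q|) / 2))) i ≤ ∑' i, |p * dx i + q * dy i| := by
    rw [indicator_univ]
    exact (summable_vv (C.sb p q) (fun i => abs_nonneg _) _).tsum_le_tsum
      (fun i => mul_le_of_le_one_right (abs_nonneg _) (vv_le_one _ _ _)) (C.sb p q)
  linarith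

lemma smin (C : Cfg ax ay dx dy) : Summable fun i => min |dx i| |dy i| :=
  Summable.of_nonneg_of_le (fun _ => le_min (abs_nonneg _) (abs_nonneg _))
    (fun _ => min_le_left _ _) C.sx

lemma smax (C : Cfg ax ay dx dy) : Summable fun i => max |dx i| |dy i| :=
  Summable.of_nonneg_of_le (fun _ => le_max_of_le_left (abs_nonneg _))
    (fun _ => max_le_add_of_nonneg (abs_nonneg _) (abs_nonneg _)) (C.sx.add C.sy)

end Cfg

/-- a configuration with quantitative smallness `δ`. -/
structure Tight (ax ay dx dy : ℕ → ℝ) (δ : ℝ) : Prop extends Cfg ax ay dx dy where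
  hmin : ∑' i, min |dx i| |dy i| ≤ δ
  hx : ∑' i, |dx i| ≤ 1 + δ
  hy : ∑' i, |dy i| ≤ 1 + δ
  hxy : ∑' i, |dx i| + ∑' i, |dy i| ≤ 2 + δ

lemma max_abs_eq (x y : ℝ) : |x + y| + |x - y| = 2 * max |x| |y| := by
  rcases le_total |x| |y| with h | h
  · rw [max_eq_right h]
    rcases abs_cases x with ⟨h1, _⟩ | ⟨h1, _⟩ <;> rcases abs_cases y with ⟨h2, _⟩ | ⟨h2, _⟩ <;>
    rcases abs_cases (x + y) with ⟨h3, _⟩ | ⟨h3, _⟩ <;>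
    rcases abs_cases (x - y) with ⟨h4, _⟩ | ⟨h4, _⟩ <;> linarith
  · rw [max_eq_left h]
    rcases abs_cases x with ⟨h1, _⟩ | ⟨h1, _⟩ <;> rcases abs_cases y with ⟨h2, _⟩ | ⟨h2, _⟩ <;>
    rcases abs_cases (x + y) with ⟨h3, _⟩ | ⟨h3, _⟩ <;>
    rcases abs_cases (x - y) with ⟨h4, _⟩ | ⟨h4, _⟩ <;> linarith

lemma max_le_len (x y : ℝ) : max |x| |y| ≤ Real.sqrt (x ^ 2 + y ^ 2) := by
  refine max_le ?_ ?_
  · exact Real.abs_le_sqrt (by nlinarith [sq_nonneg y])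
  · exact Real.abs_le_sqrt (by nlinarith [sq_nonneg x])

lemma min_le_len (x y lam : ℝ) (hl : 0 < lam) : min |x| |y| ≤
    (lam * Real.sqrt (x ^ 2 + y ^ 2) + 2 / lam * (Real.sqrt (x ^ 2 + y ^ 2) - max |x| |y|)) / 2 := by
  have hm := max_le_len x y
  set l := Real.sqrt (x ^ 2 + y ^ 2) with hl'
  have hl2 : l ^ 2 = x ^ 2 + y ^ 2 := Real.sq_sqrt (by positivity)
  have hs : min |x| |y| ^ 2 + max |x| |y| ^ 2 = l ^ 2 := by
    rw [hl2]
    rcases le_total |x| |y| with h | h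
    · rw [min_eq_left h, max_eq_right h, sq_abs, sq_abs]
    · rw [min_eq_right h, max_eq_left h, sq_abs, sq_abs]; ring
  have h0 : 0 ≤ min |x| |y| := le_min (abs_nonneg _) (abs_nonneg _)
  have h1 : 0 ≤ max |x| |y| := le_max_of_le_left (abs_nonneg _)
  set n := min |x| |y|
  set m := max |x| |y|
  have hln : 0 ≤ l := Real.sqrt_nonneg _
  have hlm : 0 ≤ l - m := by linarith
  have h2 : n ^ 2 ≤ (lam * l) * (2 / lam * (l - m)) := by
    have : (lam * l) * (2 / lam * (l - m)) = 2 * l * (l - m) := by field_simp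
    rw [this]; nlinarith
  have hA : 0 ≤ lam * l := by positivity
  have hB : 0 ≤ 2 / lam * (l - m) := by positivity
  set A := lam * l
  set B := 2 / lam * (l - m)
  nlinarith [sq_nonneg (A - B), abs_le_of_sq_le_sq' (show (n) ^ 2 ≤ ((A + B) / 2) ^ 2 by
    nlinarith [sq_nonneg (A - B)]) (by positivity)]

lemma Cfg.tight {ax ay dx dy : ℕ → ℝ} (C : Cfg ax ay dx dy)
    (hs : Summable fun i => Real.sqrt (dx i ^ 2 + dy i ^ 2))
    (hL : ∑' i, Real.sqrt (dx i ^ 2 + dy i ^ 2) < 2 + 1 / 10 ^ 12) :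
    Tight ax ay dx dy (3 / 10 ^ 6) := by
  have h11 := C.length_ge 1 1 (by norm_num)
  have h12 := C.length_ge 1 (-1) (by norm_num)
  have h10 := C.length_ge 1 0 (by norm_num)
  have h01 := C.length_ge 0 1 (by norm_num)
  have hmax : 2 ≤ ∑' i, max |dx i| |dy i| := by
    have e : (∑' i, |1 * dx i + 1 * dy i|) + (∑' i, |1 * dx i + (-1) * dy i|) =
        2 * ∑' i, max |dx i| |dy i| := by
      rw [← (C.sb 1 1).tsum_add (C.sb 1 (-1)), ← tsum_mul_left]
      congr 1; ext i
      rw [← max_abs_eq]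
      congr 2 <;> ring
    norm_num at h11 h12 e
    linarith
  have hmin : ∑' i, min |dx i| |dy i| ≤ 25 / 10 ^ 7 := by
    have := C.smin.tsum_le_tsum (fun i => min_le_len (dx i) (dy i) (1 / 10 ^ 6) (by norm_num))
      (((hs.mul_left _).add ((hs.sub C.smax).mul_left _)).div_const 2)
    rw [tsum_div_const, (hs.mul_left _).tsum_add ((hs.sub C.smax).mul_left _), tsum_mul_left,
      tsum_mul_left, hs.tsum_sub C.smax] at this
    norm_num at this hL ⊢
    linarith
  have hsum : ∑' i, |dx i| + ∑' i, |dy i| = ∑' i, max |dx i| |dy i| + ∑' i, min |dx i| |dy i| := by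
    rw [← C.sx.tsum_add C.sy, ← C.smax.tsum_add C.smin]
    congr 1; ext i; exact (max_add_min _ _).symm
  have hmL : ∑' i, max |dx i| |dy i| ≤ ∑' i, Real.sqrt (dx i ^ 2 + dy i ^ 2) :=
    C.smax.tsum_le_tsum (fun i => max_le_len _ _) hs
  norm_num at h10 h01 hL hmin
  refine ⟨C, ?_, ?_, ?_, ?_⟩ <;> norm_num <;> linarith


lemma abs_loss (p q x y : ℝ) : |p| * |x| + |q| * |y| ≤
    |p * x + q * y| + 2 * (max |p| |q| * min |x| |y|) := by
  have h1 := abs_sub_abs_le_abs_sub (p * x) (-(q * y))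
  have h2 := abs_sub_abs_le_abs_sub (q * y) (-(p * x))
  rw [abs_neg, sub_neg_eq_add, abs_mul, abs_mul] at h1 h2
  rw [add_comm (q * y)] at h2
  rcases le_total |x| |y| with h | h
  · rw [min_eq_left h]
    have : |p| * |x| ≤ max |p| |q| * |x| :=
      mul_le_mul_of_nonneg_right (le_max_left _ _) (abs_nonneg _)
    linarith
  · rw [min_eq_right h]
    have : |q| * |y| ≤ max |p| |q| * |y| :=
      mul_le_mul_of_nonneg_right (le_max_right _ _) (abs_nonneg _)
    linarith

lemma loss_A (w v f n : ℝ) (hn : 0 ≤ n) (hf : 0 ≤ f) (h1 : w ≤ v + 2 * (2 * n)) (h2 : f ≤ 27/4) :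
    w * f ≤ v * f + 27 * n := by
  nlinarith

lemma loss_B (w v f n : ℝ) (hn : 0 ≤ n) (h1 : w ≤ v + 2 * (1 * n)) (h0 : v ≤ w) (h2 : f ≤ 2) :
    w * f ≤ v * f + 4 * n := by
  nlinarith

lemma comb3 (W1 V1 X1 W2 V2 X2 Z n : ℝ) (h1 : W1 * X1 ≤ V1 * X1 + 4 * n)
    (h2 : W2 * X2 ≤ V2 * X2 + 4 * n) :
    1/2 * (W1 * X1) + 1/2 * (W2 * X2) + Z ≤ 1/2 * V1 * X1 + 1/2 * V2 * X2 + Z + 4 * n := by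
  linarith

lemma comb8 (L Z W1 V1 W2 V2 W3 V3 W4 V4 W5 V5 W6 V6 V7 V8 n : ℝ)
    (hid : L + Z = W1 + W2 + W3 + W4 + W5 + W6 + V7 + V8) (hZ : 0 ≤ Z)
    (h1 : W1 ≤ V1 + 27 * n) (h2 : W2 ≤ V2 + 27 * n) (h3 : W3 ≤ V3 + 27 * n)
    (h4 : W4 ≤ V4 + 27 * n) (h5 : W5 ≤ V5) (h6 : W6 ≤ V6) :
    L ≤ V1 + V2 + V3 + V4 + V5 + V6 + V7 + V8 + 108 * n := by
  linarith

namespace Tight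

variable {ax ay dx dy : ℕ → ℝ} {δ : ℝ}

lemma length_le (C : Tight ax ay dx dy δ) (p q : ℝ) :
    ∑' i, |p * dx i + q * dy i| ≤ |p| + |q| + max |p| |q| * δ := by
  have h : ∑' i, |p * dx i + q * dy i| ≤ |p| * ∑' i, |dx i| + |q| * ∑' i, |dy i| := by
    rw [← tsum_mul_left, ← tsum_mul_left, ← (C.sx.mul_left |p|).tsum_add (C.sy.mul_left |q|)]
    refine (C.sb p q).tsum_le_tsum (fun i => ?_) ((C.sx.mul_left |p|).add (C.sy.mul_left |q|))
    rw [← abs_mul, ← abs_mul]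
    exact abs_add_le _ _
  have h1 := C.hx
  have h2 := C.hy
  have h3 := C.hxy
  have hp := abs_nonneg p
  have hq := abs_nonneg q
  rcases le_total |p| |q| with hh | hh
  · rw [max_eq_right hh]
    nlinarith
  · rw [max_eq_left hh]
    nlinarith

lemma bnd (C : Cfg ax ay dx dy) (p q : ℝ) (i : ℕ) (u : ℝ) (hu : u ∈ Icc (0:ℝ) 1) :
    |(p * ax i + q * ay i) + u * (p * dx i + q * dy i)| ≤ |p| + |q| := by
  have h1 := C.boxx i u hu
  have h2 := C.boxy i u hu
  have e : (p * ax i + q * ay i) + u * (p * dx i + q * dy i) =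
    p * (ax i + u * dx i) + q * (ay i + u * dy i) := by ring
  rw [e]
  refine (abs_add_le _ _).trans ?_
  rw [abs_mul, abs_mul]
  exact add_le_add (mul_le_of_le_one_right (abs_nonneg _) h1)
    (mul_le_of_le_one_right (abs_nonneg _) h2)

lemma mom (C : Tight ax ay dx dy δ) (p q R h K : ℝ) (hpq : p ≠ 0 ∨ q ≠ 0)
    (hR : |p| + |q| = R) (hh : R = 2 * h)
    (φ : ℝ → ℝ) (hφ : Continuous φ) (hK0 : 0 ≤ K) (hK : ∀ t, |t| ≤ R → φ t ≤ K) :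
    (Summable fun i => |p * dx i + q * dy i| *
      ∫ u in (0:ℝ)..1, φ ((p * ax i + q * ay i) + u * (p * dx i + q * dy i))) ∧
    ∑' i, |p * dx i + q * dy i| *
      ∫ u in (0:ℝ)..1, φ ((p * ax i + q * ay i) + u * (p * dx i + q * dy i)) ≤
      (∫ t in (-h)..h, φ t) + K * (max |p| |q| * δ) := by
  have hR0 : 0 ≤ R := by rw [← hR]; positivity
  have h1 := moment (fun i => p * ax i + q * ay i) (fun i => p * dx i + q * dy i)
    (C.sb p q) R h K (by linarith) (by linarith)
    (fun i u hu => by rw [← hR]; exact bnd C.toCfg p q i u hu)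
    (fun t ht => C.cov p q t hpq (by linarith)) φ hφ hK
  refine ⟨h1.1, h1.2.trans ?_⟩
  have h2 := C.length_le p q
  have : ∑' i, |p * dx i + q * dy i| - 2 * h ≤ max |p| |q| * δ := by linarith
  nlinarith

set_option maxHeartbeats 1000000 in
lemma quartic (C : Tight ax ay dx dy δ) :
    (Summable fun i => |dx i| * ∫ u in (0:ℝ)..1, ((ay i + u * dy i) ^ 2 - 1 / 4) ^ 2) ∧
    ∑' i, |dx i| * ∫ u in (0:ℝ)..1, ((ay i + u * dy i) ^ 2 - 1 / 4) ^ 2 ≤ 163 * δ := by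
  have hδ : 0 ≤ δ := le_trans (tsum_nonneg fun i => le_min (abs_nonneg _) (abs_nonneg _)) C.hmin
  set f2 : ℝ → ℝ := fun t => t ^ 4 / 12 with hf2
  set f1 : ℝ → ℝ := fun t => -t ^ 4 - t ^ 2 / 4 with hf1
  set f0 : ℝ → ℝ := fun t => -(7/2) * t ^ 4 + t ^ 2 / 2 + 1 / 16 with hf0
  have c2 : Continuous f2 := by fun_prop
  have c1 : Continuous f1 := by fun_prop
  have c0 : Continuous f0 := by fun_prop
  have b2 : ∀ t, |t| ≤ 3 → f2 t ≤ 27/4 := by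
    intro t ht
    have : t ^ 2 ≤ 9 := by nlinarith [abs_nonneg t, sq_abs t]
    simp only [hf2]; nlinarith [sq_nonneg t]
  have b1 : ∀ t, |t| ≤ 2 → f1 t ≤ 0 := by
    intro t ht
    simp only [hf1]; nlinarith [sq_nonneg t, sq_nonneg (t^2)]
  have b0 : ∀ t, |t| ≤ 1 → f0 t ≤ 1/10 := by
    intro t ht
    simp only [hf0]; nlinarith [sq_nonneg (t^2 - 1/14)]
  have i2 : ∫ t in (-(3/2 : ℝ))..(3/2), f2 t = 81/320 := by
    simp only [hf2, intervalIntegral.integral_div, integral_pow]; norm_num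
  have i1 : ∫ t in (-(1 : ℝ))..1, f1 t = -17/30 := by
    simp only [hf1]
    rw [intervalIntegral.integral_sub (Continuous.intervalIntegrable (by fun_prop) _ _)
      (Continuous.intervalIntegrable (by fun_prop) _ _)]
    simp only [intervalIntegral.integral_neg, intervalIntegral.integral_div, integral_pow]; norm_num
  have i0 : ∫ t in (-(1/2 : ℝ))..(1/2), f0 t = 29/480 := by
    simp only [hf0]
    rw [intervalIntegral.integral_add (Continuous.intervalIntegrable (by fun_prop) _ _)
      (Continuous.intervalIntegrable (by fun_prop) _ _),
      intervalIntegral.integral_add (Continuous.intervalIntegrable (by fun_prop) _ _)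
      (Continuous.intervalIntegrable (by fun_prop) _ _)]
    simp only [intervalIntegral.integral_const_mul, intervalIntegral.integral_div, integral_pow,
      intervalIntegral.integral_const]
    norm_num
  obtain ⟨s1, t1⟩ := C.mom 1 2 3 (3/2) (27/4) (by norm_num) (by norm_num) (by norm_num) f2 c2
    (by norm_num) b2
  obtain ⟨s2, t2⟩ := C.mom 1 (-2) 3 (3/2) (27/4) (by norm_num) (by norm_num) (by norm_num) f2 c2
    (by norm_num) b2
  obtain ⟨s3, t3⟩ := C.mom 2 1 3 (3/2) (27/4) (by norm_num) (by norm_num) (by norm_num) f2 c2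
    (by norm_num) b2
  obtain ⟨s4, t4⟩ := C.mom 2 (-1) 3 (3/2) (27/4) (by norm_num) (by norm_num) (by norm_num) f2 c2
    (by norm_num) b2
  obtain ⟨s5, t5⟩ := C.mom 1 1 2 1 0 (by norm_num) (by norm_num) (by norm_num) f1 c1
    (by norm_num) b1
  obtain ⟨s6, t6⟩ := C.mom 1 (-1) 2 1 0 (by norm_num) (by norm_num) (by norm_num) f1 c1
    (by norm_num) b1
  obtain ⟨s7, t7⟩ := C.mom 1 0 1 (1/2) (1/10) (by norm_num) (by norm_num) (by norm_num) f0 c0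
    (by norm_num) b0
  obtain ⟨s8, t8⟩ := C.mom 0 1 1 (1/2) (1/10) (by norm_num) (by norm_num) (by norm_num) f0 c0
    (by norm_num) b0
  rw [i2] at t1 t2 t3 t4
  rw [i1] at t5 t6
  rw [i0] at t7 t8
  have m1 : max |(1:ℝ)| |(2:ℝ)| = 2 := by norm_num
  have m2 : max |(1:ℝ)| |(-2:ℝ)| = 2 := by norm_num
  have m3 : max |(2:ℝ)| |(1:ℝ)| = 2 := by norm_num
  have m4 : max |(2:ℝ)| |(-1:ℝ)| = 2 := by norm_num
  have m7 : max |(1:ℝ)| |(0:ℝ)| = 1 := by norm_num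
  have m8 : max |(0:ℝ)| |(1:ℝ)| = 1 := by norm_num
  rw [m1] at t1
  rw [m2] at t2
  rw [m3] at t3
  rw [m4] at t4
  rw [m7] at t7
  rw [m8] at t8
  have sall := (((((((s1.add s2).add s3).add s4).add s5).add s6).add s7).add s8).add
    (C.smin.mul_left 108)
  -- termwise bound
  have key : ∀ i, |dx i| * ∫ u in (0:ℝ)..1, ((ay i + u * dy i) ^ 2 - 1 / 4) ^ 2 ≤
      |1 * dx i + 2 * dy i| * (∫ u in (0:ℝ)..1, f2 ((1 * ax i + 2 * ay i) + u * (1 * dx i + 2 * dy i)))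
      + |1 * dx i + (-2) * dy i| *
        (∫ u in (0:ℝ)..1, f2 ((1 * ax i + (-2) * ay i) + u * (1 * dx i + (-2) * dy i)))
      + |2 * dx i + 1 * dy i| * (∫ u in (0:ℝ)..1, f2 ((2 * ax i + 1 * ay i) + u * (2 * dx i + 1 * dy i)))
      + |2 * dx i + (-1) * dy i| *
        (∫ u in (0:ℝ)..1, f2 ((2 * ax i + (-1) * ay i) + u * (2 * dx i + (-1) * dy i)))
      + |1 * dx i + 1 * dy i| * (∫ u in (0:ℝ)..1, f1 ((1 * ax i + 1 * ay i) + u * (1 * dx i + 1 * dy i)))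
      + |1 * dx i + (-1) * dy i| *
        (∫ u in (0:ℝ)..1, f1 ((1 * ax i + (-1) * ay i) + u * (1 * dx i + (-1) * dy i)))
      + |1 * dx i + 0 * dy i| * (∫ u in (0:ℝ)..1, f0 ((1 * ax i + 0 * ay i) + u * (1 * dx i + 0 * dy i)))
      + |0 * dx i + 1 * dy i| * (∫ u in (0:ℝ)..1, f0 ((0 * ax i + 1 * ay i) + u * (0 * dx i + 1 * dy i)))
      + 108 * min |dx i| |dy i| := by
    intro i
    have hn : 108 * min |dx i| |dy i| = ∫ _ in (0:ℝ)..1, 108 * min |dx i| |dy i| := by simp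
    rw [hn]
    simp only [← intervalIntegral.integral_const_mul]
    iterate 8 rw [← intervalIntegral.integral_add (Continuous.intervalIntegrable (by fun_prop) _ _)
      (Continuous.intervalIntegrable (by fun_prop) _ _)]
    refine intervalIntegral.integral_mono_on zero_le_one
      (Continuous.intervalIntegrable (by fun_prop) _ _)
      (Continuous.intervalIntegrable (by fun_prop) _ _) fun u hu => ?_
    have l1 := abs_loss 1 2 (dx i) (dy i)
    have l2 := abs_loss 1 (-2) (dx i) (dy i)
    have l3 := abs_loss 2 1 (dx i) (dy i)
    have l4 := abs_loss 2 (-1) (dx i) (dy i)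
    have l5 := abs_add_le (1 * dx i) (1 * dy i)
    have l6 := abs_add_le (1 * dx i) (-1 * dy i)
    rw [m1] at l1
    rw [m2] at l2
    rw [m3] at l3
    rw [m4] at l4
    rw [abs_mul, abs_mul] at l5 l6
    have g1 := bnd C.toCfg 1 2 i u hu
    have g2 := bnd C.toCfg 1 (-2) i u hu
    have g3 := bnd C.toCfg 2 1 i u hu
    have g4 := bnd C.toCfg 2 (-1) i u hu
    have r1 := b2 _ (g1.trans (by norm_num))
    have r2 := b2 _ (g2.trans (by norm_num))
    have r3 := b2 _ (g3.trans (by norm_num))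
    have r4 := b2 _ (g4.trans (by norm_num))
    have p2 : ∀ t, 0 ≤ f2 t := fun t => by simp only [hf2]; positivity
    have p1 : ∀ t, f1 t ≤ 0 := fun t => by
      have h1 : 0 ≤ t ^ 4 := by positivity
      have h2 : 0 ≤ t ^ 2 := by positivity
      simp only [hf1]; linarith
    have hn0 : 0 ≤ min |dx i| |dy i| := le_min (abs_nonneg _) (abs_nonneg _)
    have B : ∀ w v t : ℝ, v ≤ w → w * f1 t ≤ v * f1 t := by
      intro w v t h1
      exact mul_le_mul_of_nonpos_right h1 (p1 t)
    have k1 := loss_A _ _ _ _ hn0 (p2 _) l1 r1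
    have k2 := loss_A _ _ _ _ hn0 (p2 _) l2 r2
    have k3 := loss_A _ _ _ _ hn0 (p2 _) l3 r3
    have k4 := loss_A _ _ _ _ hn0 (p2 _) l4 r4
    have k5 := B _ _ (1 * ax i + 1 * ay i + u * (1 * dx i + 1 * dy i)) l5
    have k6 := B _ _ (1 * ax i + -1 * ay i + u * (1 * dx i + -1 * dy i)) l6
    have hid : |dx i| * ((ay i + u * dy i) ^ 2 - 1 / 4) ^ 2 +
        |dy i| * ((ax i + u * dx i) ^ 2 - 1 / 4) ^ 2 =
      (|(1:ℝ)| * |dx i| + |(2:ℝ)| * |dy i|) * f2 ((1 * ax i + 2 * ay i) + u * (1 * dx i + 2 * dy i))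
      + (|(1:ℝ)| * |dx i| + |(-2:ℝ)| * |dy i|) *
          f2 ((1 * ax i + -2 * ay i) + u * (1 * dx i + -2 * dy i))
      + (|(2:ℝ)| * |dx i| + |(1:ℝ)| * |dy i|) * f2 ((2 * ax i + 1 * ay i) + u * (2 * dx i + 1 * dy i))
      + (|(2:ℝ)| * |dx i| + |(-1:ℝ)| * |dy i|) *
          f2 ((2 * ax i + -1 * ay i) + u * (2 * dx i + -1 * dy i))
      + (|(1:ℝ)| * |dx i| + |(1:ℝ)| * |dy i|) * f1 ((1 * ax i + 1 * ay i) + u * (1 * dx i + 1 * dy i))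
      + (|(1:ℝ)| * |dx i| + |(-1:ℝ)| * |dy i|) *
          f1 ((1 * ax i + -1 * ay i) + u * (1 * dx i + -1 * dy i))
      + |1 * dx i + 0 * dy i| * f0 ((1 * ax i + 0 * ay i) + u * (1 * dx i + 0 * dy i))
      + |0 * dx i + 1 * dy i| * f0 ((0 * ax i + 1 * ay i) + u * (0 * dx i + 1 * dy i)) := by
      simp only [hf2, hf1, hf0, abs_neg, abs_one, abs_two, one_mul, zero_mul, add_zero, zero_add]
      ring
    have hpos : 0 ≤ |dy i| * ((ax i + u * dx i) ^ 2 - 1 / 4) ^ 2 := by positivity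
    exact comb8 _ _ _ _ _ _ _ _ _ _ _ _ _ _ _ _ _ hid hpos k1 k2 k3 k4 k5 k6
  have snn : ∀ i, 0 ≤ |dx i| * ∫ u in (0:ℝ)..1, ((ay i + u * dy i) ^ 2 - 1 / 4) ^ 2 := fun i =>
    mul_nonneg (abs_nonneg _) (intervalIntegral.integral_nonneg zero_le_one fun u _ => by positivity)
  have hs := Summable.of_nonneg_of_le snn key sall
  refine ⟨hs, ?_⟩
  have hfin := hs.tsum_le_tsum key sall
  rw [(((((((s1.add s2).add s3).add s4).add s5).add s6).add s7).add s8).tsum_add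
    (C.smin.mul_left 108), ((((((s1.add s2).add s3).add s4).add s5).add s6).add s7).tsum_add s8,
    (((((s1.add s2).add s3).add s4).add s5).add s6).tsum_add s7,
    ((((s1.add s2).add s3).add s4).add s5).tsum_add s6,
    (((s1.add s2).add s3).add s4).tsum_add s5, ((s1.add s2).add s3).tsum_add s4,
    (s1.add s2).tsum_add s3, s1.tsum_add s2, tsum_mul_left] at hfin
  have := C.hmin
  linarith

lemma first (C : Tight ax ay dx dy δ) (s : ℝ) (hs1 : |s| = 1) :
    (Summable fun i => |dx i| * ∫ u in (0:ℝ)..1, s * (ay i + u * dy i)) ∧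
    ∑' i, |dx i| * ∫ u in (0:ℝ)..1, s * (ay i + u * dy i) ≤ 7 * δ := by
  have hδ : 0 ≤ δ := le_trans (tsum_nonneg fun i => le_min (abs_nonneg _) (abs_nonneg _)) C.hmin
  have ca : Continuous fun t : ℝ => s * t := by fun_prop
  have cb : Continuous fun t : ℝ => (-s) * t := by fun_prop
  have b : ∀ R, ∀ t, |t| ≤ R → s * t ≤ R := fun R t ht => by
    refine (le_abs_self _).trans ?_
    rw [abs_mul, hs1, one_mul]; exact ht
  have b' : ∀ R, ∀ t, |t| ≤ R → (-s) * t ≤ R := fun R t ht => by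
    refine (le_abs_self _).trans ?_
    rw [abs_mul, abs_neg, hs1, one_mul]; exact ht
  obtain ⟨s1, t1⟩ := C.mom 1 1 2 1 2 (by norm_num) (by norm_num) (by norm_num) _ ca
    (by norm_num) (b 2)
  obtain ⟨s2, t2⟩ := C.mom 1 (-1) 2 1 2 (by norm_num) (by norm_num) (by norm_num) _ cb
    (by norm_num) (b' 2)
  obtain ⟨s3, t3⟩ := C.mom 0 1 1 (1/2) 1 (by norm_num) (by norm_num) (by norm_num) _ cb
    (by norm_num) (b' 1)
  have m1 : max |(1:ℝ)| |(1:ℝ)| = 1 := by norm_num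
  have m2 : max |(1:ℝ)| |(-1:ℝ)| = 1 := by norm_num
  have m3 : max |(0:ℝ)| |(1:ℝ)| = 1 := by norm_num
  rw [intervalIntegral.integral_const_mul, integral_id, m1] at t1
  rw [intervalIntegral.integral_const_mul, integral_id, m2] at t2
  rw [intervalIntegral.integral_const_mul, integral_id, m3] at t3
  have sall := (((s1.mul_left (1/2)).add (s2.mul_left (1/2))).add s3).add (C.smin.mul_left 4)
  have key : ∀ i, |dx i| * ∫ u in (0:ℝ)..1, s * (ay i + u * dy i) ≤
      1/2 * (|1 * dx i + 1 * dy i| *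
        (∫ u in (0:ℝ)..1, s * ((1 * ax i + 1 * ay i) + u * (1 * dx i + 1 * dy i))))
      + 1/2 * (|1 * dx i + (-1) * dy i| *
        (∫ u in (0:ℝ)..1, (-s) * ((1 * ax i + (-1) * ay i) + u * (1 * dx i + (-1) * dy i))))
      + |0 * dx i + 1 * dy i| *
        (∫ u in (0:ℝ)..1, (-s) * ((0 * ax i + 1 * ay i) + u * (0 * dx i + 1 * dy i)))
      + 4 * min |dx i| |dy i| := by
    intro i
    have hn : 4 * min |dx i| |dy i| = ∫ _ in (0:ℝ)..1, 4 * min |dx i| |dy i| := by simp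
    rw [hn, ← mul_assoc, ← mul_assoc]
    rw [← intervalIntegral.integral_const_mul |dx i|, ← intervalIntegral.integral_const_mul (1/2 * _),
      ← intervalIntegral.integral_const_mul (1/2 * _), ← intervalIntegral.integral_const_mul |_|]
    iterate 3 rw [← intervalIntegral.integral_add (Continuous.intervalIntegrable (by fun_prop) _ _)
      (Continuous.intervalIntegrable (by fun_prop) _ _)]
    refine intervalIntegral.integral_mono_on zero_le_one
      (Continuous.intervalIntegrable (by fun_prop) _ _)
      (Continuous.intervalIntegrable (by fun_prop) _ _) fun u hu => ?_
    have l1 := abs_loss 1 1 (dx i) (dy i)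
    have l2 := abs_loss 1 (-1) (dx i) (dy i)
    have l5 := abs_add_le (1 * dx i) (1 * dy i)
    have l6 := abs_add_le (1 * dx i) (-1 * dy i)
    rw [m1] at l1
    rw [m2] at l2
    rw [abs_mul, abs_mul] at l5 l6
    have g1 := bnd C.toCfg 1 1 i u hu
    have g2 := bnd C.toCfg 1 (-1) i u hu
    have hn0 : 0 ≤ min |dx i| |dy i| := le_min (abs_nonneg _) (abs_nonneg _)
    have k1 := loss_B _ _ _ _ hn0 l1 l5 (b 2 _ (g1.trans (by norm_num)))
    have k2 := loss_B _ _ _ _ hn0 l2 l6 (b' 2 _ (g2.trans (by norm_num)))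
    have hid : |dx i| * (s * (ay i + u * dy i)) =
        1/2 * ((|(1:ℝ)| * |dx i| + |(1:ℝ)| * |dy i|) *
          (s * ((1 * ax i + 1 * ay i) + u * (1 * dx i + 1 * dy i))))
        + 1/2 * ((|(1:ℝ)| * |dx i| + |(-1:ℝ)| * |dy i|) *
          (-s * ((1 * ax i + -1 * ay i) + u * (1 * dx i + -1 * dy i))))
        + |0 * dx i + 1 * dy i| * (-s * ((0 * ax i + 1 * ay i) + u * (0 * dx i + 1 * dy i))) := by
      simp only [abs_neg, abs_one, one_mul, zero_mul, zero_add]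
      ring
    rw [hid]
    exact comb3 _ _ _ _ _ _ _ _ k1 k2
  have hs : Summable fun i => |dx i| * ∫ u in (0:ℝ)..1, s * (ay i + u * dy i) := by
    refine Summable.of_norm_bounded C.sx fun i => ?_
    rw [Real.norm_eq_abs, abs_mul, abs_abs]
    refine mul_le_of_le_one_right (abs_nonneg _) ?_
    have := intervalIntegral.norm_integral_le_of_norm_le_const (a := (0:ℝ)) (b := 1) (C := 1)
      (f := fun u => s * (ay i + u * dy i)) (by
        intro u hu
        rw [uIoc_of_le zero_le_one] at hu
        rw [Real.norm_eq_abs, abs_mul, hs1, one_mul]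
        exact C.boxy i u ⟨hu.1.le, hu.2⟩)
    simpa using this
  refine ⟨hs, ?_⟩
  have hfin := hs.tsum_le_tsum key sall
  rw [(((s1.mul_left (1/2)).add (s2.mul_left (1/2))).add s3).tsum_add (C.smin.mul_left 4),
    ((s1.mul_left (1/2)).add (s2.mul_left (1/2))).tsum_add s3,
    (s1.mul_left (1/2)).tsum_add (s2.mul_left (1/2)), tsum_mul_left, tsum_mul_left,
    tsum_mul_left] at hfin
  have := C.hmin
  linarith

end Tight


/-- point of segment `i` with parameter `u`. -/
def spt (ax ay dx dy : ℕ → ℝ) (i : ℕ) (u : ℝ) : ℝ × ℝ := (ax i + u * dx i, ay i + u * dy i)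

/-- union of the segments with index in `S`. -/
def segS (ax ay dx dy : ℕ → ℝ) (S : Set ℕ) : Set (ℝ × ℝ) :=
  ⋃ i ∈ S, spt ax ay dx dy i '' Icc (0:ℝ) 1

/-- horizontal length measure on the segments with index in `S`. -/
def segM (ax ay dx dy : ℕ → ℝ) (S : Set ℕ) : Measure (ℝ × ℝ) :=
  Measure.sum fun i => ENNReal.ofReal (S.indicator (fun i => |dx i|) i) •
    (volume.restrict (Icc (0:ℝ) 1)).map (spt ax ay dx dy i)

lemma continuous_spt (ax ay dx dy : ℕ → ℝ) (i : ℕ) : Continuous (spt ax ay dx dy i) := by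
  unfold spt; fun_prop

lemma continuous_fc (c : ℝ) : Continuous (fc c) := by
  unfold fc; fun_prop

lemma fc_spt (ax ay dx dy : ℕ → ℝ) (i : ℕ) (c u : ℝ) :
    fc c (spt ax ay dx dy i u) = (1 * ax i + c * ay i) + u * (1 * dx i + c * dy i) := by
  simp only [fc, spt]; ring

lemma measurableSet_segS (ax ay dx dy : ℕ → ℝ) (S : Set ℕ) :
    MeasurableSet (segS ax ay dx dy S) :=
  MeasurableSet.biUnion (to_countable S) fun i _ =>
    (isCompact_Icc.image (continuous_spt ax ay dx dy i)).isClosed.measurableSet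

lemma measurableSet_fc_segS (ax ay dx dy : ℕ → ℝ) (S : Set ℕ) (c : ℝ) :
    MeasurableSet (fc c '' segS ax ay dx dy S) := by
  rw [segS, image_iUnion₂]
  exact MeasurableSet.biUnion (to_countable S) fun i _ =>
    ((isCompact_Icc.image (continuous_spt ax ay dx dy i)).image
      (continuous_fc c)).isClosed.measurableSet

lemma measurableSet_hit (ax ay dx dy : ℕ → ℝ) (S : Set ℕ) :
    MeasurableSet {z : (ℝ × ℝ) × ℝ | hitAt (segS ax ay dx dy S) z.1 z.2} := by
  have e : {z : (ℝ × ℝ) × ℝ | hitAt (segS ax ay dx dy S) z.1 z.2} = ⋃ i ∈ S,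
      Prod.snd '' {w : (Icc (0:ℝ) 1) × ((ℝ × ℝ) × ℝ) |
        fc w.2.2 (spt ax ay dx dy i w.1) = fc w.2.2 w.2.1} := by
    ext z
    simp only [hitAt, segS, mem_ofPred_eq, mem_iUnion, mem_image, exists_prop]
    constructor
    · rintro ⟨Q, ⟨i, hi, u, hu, rfl⟩, h⟩
      exact ⟨i, hi, (⟨u, hu⟩, z), h, rfl⟩
    · rintro ⟨i, hi, ⟨⟨u, hu⟩, z'⟩, h, rfl⟩
      exact ⟨_, ⟨i, hi, u, hu, rfl⟩, h⟩
  rw [e]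
  refine MeasurableSet.biUnion (to_countable S) fun i _ => IsClosed.measurableSet ?_
  refine isClosedMap_snd_of_compactSpace _ (isClosed_eq ?_ ?_)
  · unfold fc spt; fun_prop
  · unfold fc; fun_prop

lemma segM_compl (ax ay dx dy : ℕ → ℝ) (S : Set ℕ) :
    segM ax ay dx dy S (segS ax ay dx dy S)ᶜ = 0 := by
  have hm := (measurableSet_segS ax ay dx dy S).compl
  rw [segM, Measure.sum_apply _ hm, ENNReal.tsum_eq_zero]
  intro i
  rw [Measure.smul_apply, smul_eq_mul]
  by_cases hi : i ∈ S
  · rw [Measure.map_apply (continuous_spt ax ay dx dy i).measurable hm,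
      Measure.restrict_apply ((continuous_spt ax ay dx dy i).measurable hm)]
    have : spt ax ay dx dy i ⁻¹' (segS ax ay dx dy S)ᶜ ∩ Icc 0 1 = ∅ := by
      ext u
      simp only [mem_inter_iff, mem_preimage, mem_compl_iff, mem_empty_iff_false, iff_false, not_and]
      intro h hu
      exact h (mem_iUnion₂.2 ⟨i, hi, u, hu, rfl⟩)
    rw [this]; simp
  · simp [hi]

lemma segM_univ (ax ay dx dy : ℕ → ℝ) (S : Set ℕ) (hs : Summable fun i => |dx i|) :
    segM ax ay dx dy S univ = ENNReal.ofReal (∑' i, S.indicator (fun i => |dx i|) i) := by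
  rw [segM, Measure.sum_apply _ MeasurableSet.univ,
    ENNReal.ofReal_tsum_of_nonneg (fun i => indicator_nonneg (fun _ _ => abs_nonneg _) i)
      (hs.indicator S)]
  congr 1; ext i
  rw [Measure.smul_apply, Measure.map_apply (continuous_spt ax ay dx dy i).measurable
    MeasurableSet.univ]
  simp

lemma segM_fc (ax ay dx dy : ℕ → ℝ) (S : Set ℕ) (hs : Summable fun i => |dx i|) (c : ℝ)
    (E : Set ℝ) (hE : MeasurableSet E) :
    segM ax ay dx dy S (fc c ⁻¹' E) = ENNReal.ofReal (∑' i, S.indicator (fun i => |dx i| *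
      vv (1 * ax i + c * ay i) (1 * dx i + c * dy i) E) i) := by
  have hm : MeasurableSet (fc c ⁻¹' E) := (continuous_fc c).measurable hE
  rw [segM, Measure.sum_apply _ hm, ENNReal.ofReal_tsum_of_nonneg (fun i => indicator_nonneg
    (fun _ _ => mul_nonneg (abs_nonneg _) (vv_nonneg _ _ _)) i)
      ((summable_vv hs (fun i => abs_nonneg _) E).indicator S)]
  congr 1; ext i
  rw [Measure.smul_apply, Measure.map_apply (continuous_spt ax ay dx dy i).measurable hm,
    Measure.restrict_apply ((continuous_spt ax ay dx dy i).measurable hm), smul_eq_mul]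
  by_cases hi : i ∈ S
  · simp only [hi, indicator_of_mem]
    rw [ENNReal.ofReal_mul (abs_nonneg _), vv, measureReal_def, ENNReal.ofReal_toReal (vol_fin _),
      inter_comm]
    congr 2
    ext u
    simp only [mem_inter_iff, mem_preimage, fc_spt]
    rfl
  · simp [hi]

namespace Tight

variable {ax ay dx dy : ℕ → ℝ} {δ : ℝ}

lemma delta_nonneg (C : Tight ax ay dx dy δ) : 0 ≤ δ :=
  le_trans (tsum_nonneg fun _ => le_min (abs_nonneg _) (abs_nonneg _)) C.hmin

lemma dy_small (C : Tight ax ay dx dy δ) (i : ℕ) (hi : |dy i| ≤ |dx i|) : |dy i| ≤ δ := by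
  have h := C.smin.le_tsum i (fun j _ => le_min (abs_nonneg _) (abs_nonneg _))
  rw [min_eq_right hi] at h
  exact h.trans C.hmin

lemma slackA (C : Tight ax ay dx dy δ) (S : Set ℕ) (hS : ∀ i ∈ S, |dy i| ≤ |dx i|) (c : ℝ)
    (hc : |c| ≤ 5/2) (E : Set ℝ) :
    ∑' i, S.indicator (fun i => |dx i| *
      vv (1 * ax i + c * ay i) (1 * dx i + c * dy i) E) i ≤
    ∑' i, S.indicator (fun i => |1 * dx i + c * dy i| *
      vv (1 * ax i + c * ay i) (1 * dx i + c * dy i) E) i + 5/2 * δ := by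
  have s1 := (summable_vv (α := fun i => 1 * ax i + c * ay i) (β := fun i => 1 * dx i + c * dy i)
    C.sx (fun i => abs_nonneg _) E).indicator S
  have s2 := (summable_vv (α := fun i => 1 * ax i + c * ay i) (β := fun i => 1 * dx i + c * dy i)
    (C.sb 1 c) (fun i => abs_nonneg _) E).indicator S
  have h := s1.tsum_le_tsum (g := fun i => S.indicator (fun i => |1 * dx i + c * dy i| *
      vv (1 * ax i + c * ay i) (1 * dx i + c * dy i) E) i + 5/2 * min |dx i| |dy i|)
    (fun i => by
      by_cases hi : i ∈ S
      · simp only [hi, indicator_of_mem]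
        rw [min_eq_right (hS i hi)]
        have h1 : |dx i| ≤ |1 * dx i + c * dy i| + 5/2 * |dy i| := by
          have := abs_sub (1 * dx i + c * dy i) (c * dy i)
          rw [add_sub_cancel_right, one_mul, abs_mul] at this
          rw [one_mul]
          have h3 : |c| * |dy i| ≤ 5/2 * |dy i| := mul_le_mul_of_nonneg_right hc (abs_nonneg _)
          linarith
        have h2 := vv_nonneg (1 * ax i + c * ay i) (1 * dx i + c * dy i) E
        have h3 := vv_le_one (1 * ax i + c * ay i) (1 * dx i + c * dy i) E
        have h4 : 0 ≤ 5/2 * |dy i| := by positivity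
        calc _ ≤ (|1 * dx i + c * dy i| + 5/2 * |dy i|) *
              vv (1 * ax i + c * ay i) (1 * dx i + c * dy i) E :=
              mul_le_mul_of_nonneg_right h1 h2
          _ ≤ _ := by
            rw [add_mul]
            have := mul_le_of_le_one_right h4 h3
            linarith
      · simp only [hi, not_false_eq_true, indicator_of_notMem, zero_add]
        have : 0 ≤ min |dx i| |dy i| := le_min (abs_nonneg _) (abs_nonneg _)
        linarith) (s2.add (C.smin.mul_left _))
  rw [s2.tsum_add (C.smin.mul_left _), tsum_mul_left] at h
  have := C.hmin
  linarith

/-- the interval of projections of the square. -/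
def ivl (c : ℝ) : Set ℝ := Icc (-((1 + |c|) / 2)) ((1 + |c|) / 2)

lemma ivl_vol (c : ℝ) : volume.real (ivl c) = 1 + |c| := by
  have : 0 ≤ |c| := abs_nonneg c
  rw [ivl, Real.volume_real_Icc_of_le (by linarith)]; ring

lemma ivl_cov (C : Cfg ax ay dx dy) (c t : ℝ) (ht : t ∈ ivl c) :
    ∃ i, ∃ u ∈ Icc (0:ℝ) 1, (1 * ax i + c * ay i) + u * (1 * dx i + c * dy i) = t :=
  C.cov 1 c t (by norm_num) (by rw [abs_one]; exact abs_le.2 ht)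

lemma len_c (C : Tight ax ay dx dy δ) (c : ℝ) (hc : |c| ≤ 5/2) :
    ∑' i, |1 * dx i + c * dy i| ≤ 1 + |c| + 5/2 * δ := by
  have h := C.length_le 1 c
  have h0 := C.delta_nonneg
  rw [abs_one] at h
  have : max 1 |c| ≤ 5/2 := max_le (by norm_num) hc
  nlinarith

lemma slackB (C : Tight ax ay dx dy δ) (c : ℝ) (hc : |c| ≤ 5/2) (E : Set ℝ)
    (hE : MeasurableSet E) (hfin : volume E ≠ ⊤) :
    ∑' i, |1 * dx i + c * dy i| * vv (1 * ax i + c * ay i) (1 * dx i + c * dy i) E ≤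
      volume.real E + 5/2 * δ := by
  have s1 := summable_vv (α := fun i => 1 * ax i + c * ay i) (β := fun i => 1 * dx i + c * dy i)
    (C.sb 1 c) (fun i => abs_nonneg _) E
  have s2 := summable_vv (α := fun i => 1 * ax i + c * ay i) (β := fun i => 1 * dx i + c * dy i)
    (C.sb 1 c) (fun i => abs_nonneg _) Eᶜ
  have hsum : (∑' i, |1 * dx i + c * dy i| *
      vv (1 * ax i + c * ay i) (1 * dx i + c * dy i) E) + ∑' i, |1 * dx i + c * dy i| *
      vv (1 * ax i + c * ay i) (1 * dx i + c * dy i) Eᶜ = ∑' i, |1 * dx i + c * dy i| := by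
    rw [← s1.tsum_add s2]
    congr 1; ext i
    rw [← mul_add, vv_compl _ _ _ hE, mul_one]
  have s3 := summable_vv (α := fun i => 1 * ax i + c * ay i) (β := fun i => 1 * dx i + c * dy i)
    (C.sb 1 c) (fun i => abs_nonneg _) (ivl c \ E)
  have h1 := cover_real (fun i => 1 * ax i + c * ay i) (fun i => 1 * dx i + c * dy i) (C.sb 1 c)
    univ (ivl c \ E) (fun t ht => by
      obtain ⟨i, hi⟩ := ivl_cov C.toCfg c t ht.1
      exact ⟨i, mem_univ _, hi⟩)
  rw [indicator_univ] at h1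
  have subE : ivl c \ E ⊆ Eᶜ := fun t ht => ht.2
  have h2 := s3.tsum_le_tsum (fun i => mul_le_mul_of_nonneg_left
    (vv_mono (1 * ax i + c * ay i) (1 * dx i + c * dy i) subE)
    (abs_nonneg (1 * dx i + c * dy i))) s2
  have h3 : volume.real (ivl c) ≤ volume.real (ivl c \ E) + volume.real E := by
    refine (measureReal_mono (fun t ht => ?_) ?_).trans (measureReal_union_le _ _)
    · by_cases h : t ∈ E
      · exact Or.inr h
      · exact Or.inl ⟨ht, h⟩
    · refine (measure_union_lt_top ?_ (lt_top_iff_ne_top.2 hfin)).ne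
      exact lt_of_le_of_lt (measure_mono sdiff_subset) (by simp [ivl])
  rw [ivl_vol] at h3
  have := C.len_c c hc
  linarith

lemma split_sum (S : Set ℕ) (f g w : ℕ → ℝ) (sf : Summable f) (sg : Summable g)
    (h : ∀ i, f i + g i = w i) :
    (∑' i, S.indicator f i) + (∑' i, Sᶜ.indicator f i) + ∑' i, g i = ∑' i, w i := by
  rw [← (sf.indicator S).tsum_add (sf.indicator Sᶜ),
    ← ((sf.indicator S).add (sf.indicator Sᶜ)).tsum_add sg]
  refine tsum_congr fun i => ?_
  rw [← h i]
  by_cases hi : i ∈ S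
  · simp [hi]
  · simp [hi]

lemma ind_tsum_le (S : Set ℕ) (f g : ℕ → ℝ) (sf : Summable f) (sg : Summable g)
    (h : ∀ i, f i ≤ g i) : (∑' i, S.indicator f i) ≤ ∑' i, S.indicator g i :=
  (sf.indicator S).tsum_le_tsum (fun i => indicator_le_indicator (h i)) (sg.indicator S)

lemma slackC_real {x y z w p q L δ c : ℝ} (h : x + y + z = w) (h1 : p ≤ z) (h2 : q ≤ y)
    (h3 : q + p = 1 + L) (h4 : w ≤ 1 + L + c * δ) : x ≤ c * δ := by linarith

lemma slackC (C : Tight ax ay dx dy δ) (S : Set ℕ) (c : ℝ) (hc : |c| ≤ 5/2) (E : Set ℝ)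
    (hE : MeasurableSet E) (hcov : ∀ t ∈ ivl c ∩ E, ∃ i ∈ Sᶜ, ∃ u ∈ Icc (0:ℝ) 1,
      (1 * ax i + c * ay i) + u * (1 * dx i + c * dy i) = t) :
    ∑' i, S.indicator (fun i => |1 * dx i + c * dy i| *
      vv (1 * ax i + c * ay i) (1 * dx i + c * dy i) E) i ≤ 5/2 * δ := by
  have sv : ∀ F : Set ℝ, Summable fun i => |1 * dx i + c * dy i| *
      vv (1 * ax i + c * ay i) (1 * dx i + c * dy i) F := fun F =>
    summable_vv (α := fun i => 1 * ax i + c * ay i) (β := fun i => 1 * dx i + c * dy i)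
      (C.sb 1 c) (fun i => abs_nonneg _) F
  have mono : ∀ F G : Set ℝ, F ⊆ G → ∀ i, |1 * dx i + c * dy i| *
      vv (1 * ax i + c * ay i) (1 * dx i + c * dy i) F ≤ |1 * dx i + c * dy i| *
      vv (1 * ax i + c * ay i) (1 * dx i + c * dy i) G := fun F G h i =>
    mul_le_mul_of_nonneg_left (vv_mono _ _ h) (abs_nonneg _)
  have hsum := split_sum S _ _ (fun i => |1 * dx i + c * dy i|) (sv E) (sv Eᶜ) (fun i => by
    rw [← mul_add, vv_compl _ _ _ hE, mul_one])
  have h1 := cover_real (fun i => 1 * ax i + c * ay i) (fun i => 1 * dx i + c * dy i) (C.sb 1 c)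
    univ (ivl c \ E) (fun t ht => by
      obtain ⟨i, hi⟩ := ivl_cov C.toCfg c t ht.1
      exact ⟨i, mem_univ _, hi⟩)
  rw [indicator_univ] at h1
  have h2 := (sv (ivl c \ E)).tsum_le_tsum (mono _ _ (fun t ht => ht.2)) (sv Eᶜ)
  have h4 := cover_real (fun i => 1 * ax i + c * ay i) (fun i => 1 * dx i + c * dy i) (C.sb 1 c)
    Sᶜ (ivl c ∩ E) hcov
  have h5 := ind_tsum_le Sᶜ _ _ (sv (ivl c ∩ E)) (sv E) (mono _ _ inter_subset_right)
  have h3 := measureReal_inter_add_sdiff (μ := volume) (s := ivl c) hE (by simp [ivl])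
  rw [ivl_vol] at h3
  exact slackC_real hsum (h1.trans h2) (h4.trans h5) h3 (C.len_c c hc)

lemma h1gen (C : Tight ax ay dx dy δ) (S : Set ℕ) (hS : ∀ i ∈ S, |dy i| ≤ |dx i|) (c : ℝ)
    (hc : |c| ≤ 5/2) (E : Set ℝ) (hE : MeasurableSet E) :
    segM ax ay dx dy S (fc c ⁻¹' E) ≤ volume E + ENNReal.ofReal (5 * δ) := by
  by_cases hfin : volume E = ⊤
  · simp [hfin]
  have h0 := C.delta_nonneg
  rw [segM_fc ax ay dx dy S C.sx c E hE, ← ENNReal.ofReal_toReal hfin,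
    ← ENNReal.ofReal_add ENNReal.toReal_nonneg (by positivity)]
  refine ENNReal.ofReal_le_ofReal ?_
  have hA := C.slackA S hS c hc E
  have hB := C.slackB c hc E hE hfin
  have s0 := summable_vv (α := fun i => 1 * ax i + c * ay i) (β := fun i => 1 * dx i + c * dy i)
    (C.sb 1 c) (fun i => abs_nonneg _) E
  have hI := (s0.indicator S).tsum_le_tsum (fun i => indicator_le_self' (s := S)
    (f := fun i => |1 * dx i + c * dy i| * vv (1 * ax i + c * ay i) (1 * dx i + c * dy i) E)
    (fun j _ => mul_nonneg (abs_nonneg _) (vv_nonneg _ _ _)) i) s0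
  rw [measureReal_def] at hB
  linarith

lemma h2gen (C : Tight ax ay dx dy δ) (S : Set ℕ) (hS : ∀ i ∈ S, |dy i| ≤ |dx i|) (c : ℝ)
    (hc : |c| ≤ 5/2) (E : Set ℝ) (hE : MeasurableSet E)
    (hcov : ∀ t ∈ ivl c ∩ E, ∃ i ∈ Sᶜ, ∃ u ∈ Icc (0:ℝ) 1,
      (1 * ax i + c * ay i) + u * (1 * dx i + c * dy i) = t) :
    segM ax ay dx dy S (fc c ⁻¹' E) ≤ ENNReal.ofReal (5 * δ) := by
  rw [segM_fc ax ay dx dy S C.sx c E hE]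
  refine ENNReal.ofReal_le_ofReal ?_
  have hA := C.slackA S hS c hc E
  have hB := C.slackC S c hc E hE hcov
  linarith

lemma hit_mass (C : Tight ax ay dx dy δ) (S S' : Set ℕ) (hS : ∀ i ∈ S, |dy i| ≤ |dx i|)
    (hd : S' ⊆ Sᶜ) (c : ℝ) (hc : |c| ≤ 5/2) :
    segM ax ay dx dy S {P | P ∈ segS ax ay dx dy S ∧ hitAt (segS ax ay dx dy S') P c} ≤
      ENNReal.ofReal (5 * δ) := by
  refine le_trans (measure_mono ?_) (C.h2gen S hS c hc (fc c '' segS ax ay dx dy S')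
    (measurableSet_fc_segS ax ay dx dy S' c) ?_)
  · rintro P ⟨_, Q, hQ, h⟩
    exact ⟨Q, hQ, h⟩
  · rintro t ⟨_, Q, hQ, rfl⟩
    obtain ⟨i, hi, u, hu, rfl⟩ := mem_iUnion₂.1 hQ
    exact ⟨i, hd hi, u, hu, (fc_spt ax ay dx dy i c u).symm⟩

lemma x_mass (C : Tight ax ay dx dy δ) (S : Set ℕ) (hS : ∀ i ∈ S, |dy i| ≤ |dx i|) :
    ENNReal.ofReal (∑' i, S.indicator (fun i => |dx i|) i - 5 * δ) ≤
      segM ax ay dx dy S (segS ax ay dx dy S ∩ {P | |P.1| ≤ 1/2}) := by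
  have h0 := C.delta_nonneg
  have hmE : MeasurableSet {t : ℝ | 1/2 < |t|} := measurableSet_lt measurable_const (by fun_prop)
  have h := C.h2gen S hS 0 (by norm_num) {t | 1/2 < |t|} hmE (by
    rintro t ⟨h1, h2⟩
    exfalso
    have h1' := abs_le.2 h1
    simp only [abs_zero] at h1'
    have h2' : 1/2 < |t| := h2
    linarith)
  rw [ENNReal.ofReal_sub _ (by positivity), tsub_le_iff_right,
    ← segM_univ ax ay dx dy S C.sx]
  have hc := segM_compl ax ay dx dy S
  calc segM ax ay dx dy S univ ≤ segM ax ay dx dy S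
          ((segS ax ay dx dy S ∩ {P | |P.1| ≤ 1/2}) ∪ (fc 0 ⁻¹' {t | 1/2 < |t|}) ∪
            (segS ax ay dx dy S)ᶜ) := by
        refine measure_mono fun P _ => ?_
        by_cases h1 : P ∈ segS ax ay dx dy S
        · left
          by_cases h2 : |P.1| ≤ 1/2
          · exact Or.inl ⟨h1, h2⟩
          · right
            change 1/2 < |fc 0 P|
            rw [fc, zero_mul, add_zero]; exact not_le.1 h2
        · exact Or.inr h1
    _ ≤ _ := (measure_union_le _ _).trans (by
        rw [hc, add_zero]
        exact (measure_union_le _ _).trans (by gcongr))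

end Tight


namespace Tight

variable {ax ay dx dy : ℕ → ℝ} {δ : ℝ}

/-- indices of nearly horizontal segments starting at height in `[l, r]`. -/
def idx (ay dx dy : ℕ → ℝ) (l r : ℝ) : Set ℕ := {i | |dy i| ≤ |dx i| ∧ ay i ∈ Icc l r}

lemma y_near (C : Tight ax ay dx dy δ) (i : ℕ) (hi : |dy i| ≤ |dx i|) (u : ℝ)
    (hu : u ∈ Icc (0:ℝ) 1) : |(ay i + u * dy i) - ay i| ≤ δ := by
  have h := C.dy_small i hi
  rw [add_sub_cancel_left, abs_mul, abs_of_nonneg hu.1]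
  exact (mul_le_of_le_one_left (abs_nonneg _) hu.2).trans h

lemma int_ge (f : ℝ → ℝ) (hf : Continuous f) (m : ℝ) (h : ∀ u ∈ Icc (0:ℝ) 1, m ≤ f u) :
    m ≤ ∫ u in (0:ℝ)..1, f u := by
  have := intervalIntegral.integral_mono_on zero_le_one (μ := volume) (f := fun _ => m) (g := f)
    (by simp) (hf.intervalIntegrable _ _) h
  simpa using this

lemma rest_le (C : Tight ax ay dx dy δ) (hδ : δ ≤ 3 / 10 ^ 6) (i : ℕ) :
    |dx i| - (idx ay dx dy (3/10) (7/10)).indicator (fun i => |dx i|) i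
      - (idx ay dx dy (-(7/10)) (-(3/10))).indicator (fun i => |dx i|) i ≤
    min |dx i| |dy i| +
      40 * (|dx i| * ∫ u in (0:ℝ)..1, ((ay i + u * dy i) ^ 2 - 1 / 4) ^ 2) := by
  have hn : 0 ≤ min |dx i| |dy i| := le_min (abs_nonneg _) (abs_nonneg _)
  have hI : 0 ≤ ∫ u in (0:ℝ)..1, ((ay i + u * dy i) ^ 2 - 1 / 4) ^ 2 :=
    intervalIntegral.integral_nonneg zero_le_one fun u _ => by positivity
  have hx := abs_nonneg (dx i)
  have hp : 0 ≤ 40 * (|dx i| * ∫ u in (0:ℝ)..1, ((ay i + u * dy i) ^ 2 - 1 / 4) ^ 2) := by positivity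
  have hi1 : 0 ≤ (idx ay dx dy (3/10) (7/10)).indicator (fun i => |dx i|) i :=
    indicator_nonneg (fun _ _ => abs_nonneg _) i
  have hi2 : 0 ≤ (idx ay dx dy (-(7/10)) (-(3/10))).indicator (fun i => |dx i|) i :=
    indicator_nonneg (fun _ _ => abs_nonneg _) i
  by_cases hT : i ∈ idx ay dx dy (3/10) (7/10)
  · rw [indicator_of_mem hT]; linarith
  by_cases hB : i ∈ idx ay dx dy (-(7/10)) (-(3/10))
  · rw [indicator_of_mem hB]; linarith
  by_cases hH : |dy i| ≤ |dx i|
  swap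
  · rw [min_eq_left (not_le.1 hH).le]; linarith
  have key : 1/40 ≤ ∫ u in (0:ℝ)..1, ((ay i + u * dy i) ^ 2 - 1 / 4) ^ 2 := by
    refine int_ge _ (by fun_prop) _ fun u hu => ?_
    have hnear := abs_le.1 (C.y_near i hH u hu)
    norm_num at hδ
    set y := ay i + u * dy i with hy
    have hc : ay i < -(7/10) ∨ (-(3/10) < ay i ∧ ay i < 3/10) ∨ 7/10 < ay i := by
      by_contra hcon
      push Not at hcon
      obtain ⟨h1, h2, h3⟩ := hcon
      by_cases h4 : -(3/10) < ay i
      · exact hT ⟨hH, h2 h4, h3⟩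
      · exact hB ⟨hH, h1, not_lt.1 h4⟩
    have hsq : y ^ 2 ≤ 1/11 ∨ 12/25 ≤ y ^ 2 := by
      rcases hc with h | ⟨h1, h2⟩ | h
      · right; nlinarith
      · left; nlinarith
      · right; nlinarith
    rcases hsq with h | h <;> nlinarith
  nlinarith

lemma first_ge (C : Tight ax ay dx dy δ) (hδ : δ ≤ 3 / 10 ^ 6) (s : ℝ) (i : ℕ)
    (p q : ℝ) (hpq : (s = 1 ∧ p = 1/4 ∧ q = -(3/4)) ∨ (s = -1 ∧ p = -(3/4) ∧ q = 1/4)) :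
    p * (idx ay dx dy (3/10) (7/10)).indicator (fun i => |dx i|) i
      + q * (idx ay dx dy (-(7/10)) (-(3/10))).indicator (fun i => |dx i|) i
      - (|dx i| - (idx ay dx dy (3/10) (7/10)).indicator (fun i => |dx i|) i
      - (idx ay dx dy (-(7/10)) (-(3/10))).indicator (fun i => |dx i|) i) ≤
    |dx i| * ∫ u in (0:ℝ)..1, s * (ay i + u * dy i) := by
  have hx := abs_nonneg (dx i)
  norm_num at hδ
  have fin : ∀ m : ℝ, (∀ u ∈ Icc (0:ℝ) 1, m ≤ s * (ay i + u * dy i)) →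
      m * |dx i| ≤ |dx i| * ∫ u in (0:ℝ)..1, s * (ay i + u * dy i) := by
    intro m hm
    rw [mul_comm]
    exact mul_le_mul_of_nonneg_left (int_ge _ (by fun_prop) _ hm) hx
  by_cases hT : i ∈ idx ay dx dy (3/10) (7/10)
  · have hB : i ∉ idx ay dx dy (-(7/10)) (-(3/10)) := by
      intro h
      have h1 := hT.2.1
      have h2 := h.2.2
      linarith
    rw [indicator_of_mem hT, indicator_of_notMem hB]
    refine le_trans (le_of_eq (by ring)) (fin p fun u hu => ?_)
    have hnear := abs_le.1 (C.y_near i hT.1 u hu)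
    have h1 := hT.2.1
    have h2 := hT.2.2
    rcases hpq with ⟨rfl, rfl, rfl⟩ | ⟨rfl, rfl, rfl⟩ <;> linarith
  by_cases hB : i ∈ idx ay dx dy (-(7/10)) (-(3/10))
  · rw [indicator_of_notMem hT, indicator_of_mem hB]
    refine le_trans (le_of_eq (by ring)) (fin q fun u hu => ?_)
    have hnear := abs_le.1 (C.y_near i hB.1 u hu)
    have h1 := hB.2.1
    have h2 := hB.2.2
    rcases hpq with ⟨rfl, rfl, rfl⟩ | ⟨rfl, rfl, rfl⟩ <;> linarith
  · rw [indicator_of_notMem hT, indicator_of_notMem hB]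
    refine le_trans (le_of_eq (by ring)) (fin (-1) fun u hu => ?_)
    have hy := abs_le.1 (C.boxy i u hu)
    rcases hpq with ⟨rfl, rfl, rfl⟩ | ⟨rfl, rfl, rfl⟩ <;> linarith

lemma masses (C : Tight ax ay dx dy δ) (hδ : δ ≤ 3 / 10 ^ 6) :
    22/100 ≤ ∑' i, (idx ay dx dy (3/10) (7/10)).indicator (fun i => |dx i|) i ∧
    22/100 ≤ ∑' i, (idx ay dx dy (-(7/10)) (-(3/10))).indicator (fun i => |dx i|) i ∧
    97/100 ≤ ∑' i, (idx ay dx dy (3/10) (7/10)).indicator (fun i => |dx i|) i +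
      ∑' i, (idx ay dx dy (-(7/10)) (-(3/10))).indicator (fun i => |dx i|) i := by
  have sT := C.sx.indicator (idx ay dx dy (3/10) (7/10))
  have sB := C.sx.indicator (idx ay dx dy (-(7/10)) (-(3/10)))
  have sR := (C.sx.sub sT).sub sB
  obtain ⟨sQ, hQ⟩ := C.quartic
  have hR := sR.tsum_le_tsum (C.rest_le hδ) (C.smin.add (sQ.mul_left 40))
  rw [C.smin.tsum_add (sQ.mul_left 40), tsum_mul_left] at hR
  obtain ⟨s1, f1⟩ := C.first 1 (by norm_num)
  obtain ⟨s2, f2⟩ := C.first (-1) (by norm_num)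
  have g1 := (((sT.mul_left (1/4)).add (sB.mul_left (-(3/4)))).sub sR).tsum_le_tsum
    (fun i => C.first_ge hδ 1 i (1/4) (-(3/4)) (Or.inl ⟨rfl, rfl, rfl⟩)) s1
  have g2 := (((sT.mul_left (-(3/4))).add (sB.mul_left (1/4))).sub sR).tsum_le_tsum
    (fun i => C.first_ge hδ (-1) i (-(3/4)) (1/4) (Or.inr ⟨rfl, rfl, rfl⟩)) s2
  rw [((sT.mul_left (1/4)).add (sB.mul_left (-(3/4)))).tsum_sub sR,
    (sT.mul_left (1/4)).tsum_add (sB.mul_left (-(3/4))), tsum_mul_left, tsum_mul_left] at g1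
  rw [((sT.mul_left (-(3/4))).add (sB.mul_left (1/4))).tsum_sub sR,
    (sT.mul_left (-(3/4))).tsum_add (sB.mul_left (1/4)), tsum_mul_left, tsum_mul_left] at g2
  have eR := (C.sx.sub sT).tsum_sub sB
  rw [C.sx.tsum_sub sT] at eR
  have hmin := C.hmin
  have hX : 1 ≤ ∑' i, |dx i| := by
    have := C.length_ge 1 0 (by norm_num)
    norm_num at this
    exact this
  norm_num at hδ
  refine ⟨?_, ?_, ?_⟩ <;> linarith

theorem contra_small (C : Tight ax ay dx dy δ) (hδ : δ ≤ 3 / 10 ^ 6) : False := by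
  obtain ⟨hm1, hm2, hm3⟩ := C.masses hδ
  set T := idx ay dx dy (3/10) (7/10) with hT
  set B := idx ay dx dy (-(7/10)) (-(3/10)) with hB
  have hTH : ∀ i ∈ T, |dy i| ≤ |dx i| := fun i hi => hi.1
  have hBH : ∀ i ∈ B, |dy i| ≤ |dx i| := fun i hi => hi.1
  have hd1 : B ⊆ Tᶜ := by
    intro i h1 h2
    have h3 := h1.2.2
    have h4 := h2.2.1
    linarith
  have hd2 : T ⊆ Bᶜ := fun i h1 h2 => hd1 h2 h1
  have h0 := C.delta_nonneg
  have xT := C.x_mass T hTH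
  have xB := C.x_mass B hBH
  have uT := segM_univ ax ay dx dy T C.sx
  have uB := segM_univ ax ay dx dy B C.sx
  have : IsFiniteMeasure (segM ax ay dx dy T) := ⟨by rw [uT]; exact ENNReal.ofReal_lt_top⟩
  have : IsFiniteMeasure (segM ax ay dx dy B) := ⟨by rw [uB]; exact ENNReal.ofReal_lt_top⟩
  norm_num at hδ
  have D := dyn_lemma (segM ax ay dx dy T) (segM ax ay dx dy B) (segS ax ay dx dy T)
    (segS ax ay dx dy B) (measurableSet_segS ax ay dx dy T) (measurableSet_segS ax ay dx dy B)
    (measurableSet_hit ax ay dx dy B) (measurableSet_hit ax ay dx dy T)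
    (segM_compl ax ay dx dy T) (segM_compl ax ay dx dy B)
    (by
      intro P hP
      obtain ⟨i, hi, u, hu, rfl⟩ := mem_iUnion₂.1 hP
      have hnear := abs_le.1 (C.y_near i (hTH i hi) u hu)
      have h1 := hi.2.1
      have h2 := hi.2.2
      simp only [spt]
      constructor <;> linarith)
    (by
      intro P hP
      obtain ⟨i, hi, u, hu, rfl⟩ := mem_iUnion₂.1 hP
      have hnear := abs_le.1 (C.y_near i (hBH i hi) u hu)
      have h1 := hi.2.1
      have h2 := hi.2.2
      simp only [spt]
      constructor <;> linarith)
    (5 * δ) (by linarith) (by linarith)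
    (fun c hc E hE => C.h1gen T hTH c hc E hE) (fun c hc E hE => C.h1gen B hBH c hc E hE)
    (fun c hc => C.hit_mass T B hTH hd1 c hc) (fun c hc => C.hit_mass B T hBH hd2 c hc)
  set a := ∑' i, T.indicator (fun i => |dx i|) i
  set b := ∑' i, B.indicator (fun i => |dx i|) i
  have hprod : ENNReal.ofReal ((a - 5 * δ) * (b - 5 * δ)) ≤ ENNReal.ofReal (4200 * (5 * δ)) := by
    rw [ENNReal.ofReal_mul (by linarith)]
    refine (mul_le_mul' xT xB).trans ?_
    rw [← Measure.prod_prod]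
    refine (measure_mono ?_).trans D
    rintro ⟨P, Q⟩ ⟨⟨h1, h2⟩, ⟨h3, h4⟩⟩
    refine ⟨h1, h3, ?_⟩
    have h2' : |P.1| ≤ 1/2 := h2
    have h4' : |Q.1| ≤ 1/2 := h4
    have := abs_sub P.1 Q.1
    change |P.1 - Q.1| ≤ 1
    linarith
  rw [ENNReal.ofReal_le_ofReal_iff (by linarith)] at hprod
  nlinarith

end Tight


lemma len_eq (x : Pt) : ‖x‖ = Real.sqrt (x 0 ^ 2 + x 1 ^ 2) := by
  rw [EuclideanSpace.norm_eq, Fin.sum_univ_two]; simp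

lemma abs_half_sign (p t s : ℝ) (hs : 0 < s) (ht : |t| ≤ s / 2) :
    ∃ x : ℝ, |x| ≤ 1/2 ∧ p * x = t / s * |p| := by
  have h : |t / s| ≤ 1/2 := by
    rw [abs_div, abs_of_pos hs, div_le_iff₀ hs]; linarith
  rcases le_total 0 p with hp | hp
  · exact ⟨t / s, h, by rw [abs_of_nonneg hp]; ring⟩
  · exact ⟨-(t / s), by rwa [abs_neg], by rw [abs_of_nonpos hp]; ring⟩

lemma mkCfg (a b : ℕ → Pt)
    (hbar : IsBarrier (⋃ i, segment ℝ (a i) (b i)) unitSquare)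
    (hloc : (⋃ i, segment ℝ (a i) (b i)) ⊆
      {p : Pt | p 0 ∈ Icc (-(1/2) : ℝ) (3/2) ∧ p 1 ∈ Icc (-(1/2) : ℝ) (3/2)})
    (hsum : Summable fun i => ‖b i - a i‖) :
    Cfg (fun i => a i 0 - 1/2) (fun i => a i 1 - 1/2)
      (fun i => b i 0 - a i 0) (fun i => b i 1 - a i 1) := by
  have hbox : ∀ i, ∀ u ∈ Icc (0:ℝ) 1, (a i + u • (b i - a i) : Pt) ∈
      {p : Pt | p 0 ∈ Icc (-(1/2) : ℝ) (3/2) ∧ p 1 ∈ Icc (-(1/2) : ℝ) (3/2)} := by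
    intro i u hu
    apply hloc
    refine mem_iUnion.2 ⟨i, ?_⟩
    rw [segment_eq_image']
    exact ⟨u, hu, rfl⟩
  have hle : ∀ i, |b i 0 - a i 0| ≤ ‖b i - a i‖ ∧ |b i 1 - a i 1| ≤ ‖b i - a i‖ := by
    intro i
    rw [len_eq]
    have h := max_le_len (b i 0 - a i 0) (b i 1 - a i 1)
    exact ⟨(le_max_left _ _).trans h, (le_max_right _ _).trans h⟩
  constructor
  · intro i u hu
    have h := (hbox i u hu).1
    simp only [PiLp.add_apply, PiLp.smul_apply, PiLp.sub_apply, smul_eq_mul, mem_Icc] at h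
    rw [abs_le]; constructor <;> linarith [h.1, h.2]
  · intro i u hu
    have h := (hbox i u hu).2
    simp only [PiLp.add_apply, PiLp.smul_apply, PiLp.sub_apply, smul_eq_mul, mem_Icc] at h
    rw [abs_le]; constructor <;> linarith [h.1, h.2]
  · intro p q t hpq ht
    have hs : 0 < |p| + |q| := by
      rcases hpq with h | h
      · have := abs_pos.2 h; positivity
      · have := abs_pos.2 h; positivity
    obtain ⟨x, hx, hpx⟩ := abs_half_sign p t _ hs ht
    obtain ⟨y, hy, hqy⟩ := abs_half_sign q t _ hs ht
    have hxy : p * x + q * y = t := by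
      rw [hpx, hqy, ← mul_add, div_mul_cancel₀ _ hs.ne']
    rw [abs_le] at hx hy
    obtain ⟨z, ⟨s, hz⟩, hz2⟩ := hbar
      {z : Pt | ∃ s : ℝ, z = (!₂[1/2 + x, 1/2 + y] : Pt) + s • (!₂[-q, p] : Pt)}
      ⟨!₂[1/2 + x, 1/2 + y], !₂[-q, p], by
        intro h
        have h0 := congrArg (fun v : Pt => v 0) h
        have h1 := congrArg (fun v : Pt => v 1) h
        simp at h0 h1
        rcases hpq with h | h
        · exact h h1
        · exact h h0, rfl⟩
      ⟨!₂[1/2 + x, 1/2 + y], ⟨0, by simp⟩, by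
        constructor
        · simp only [mem_Icc]; constructor <;> simp <;> linarith [hx.1, hx.2]
        · simp only [mem_Icc]; constructor <;> simp <;> linarith [hy.1, hy.2]⟩
    obtain ⟨i, hi⟩ := mem_iUnion.1 hz2
    rw [segment_eq_image'] at hi
    obtain ⟨u, hu, hu2⟩ := hi
    refine ⟨i, u, hu, ?_⟩
    have e := hu2.trans hz
    have e0 := congrArg (fun v : Pt => v 0) e
    have e1 := congrArg (fun v : Pt => v 1) e
    simp at e0 e1
    linear_combination p * e0 + q * e1 + hxy
  · exact Summable.of_nonneg_of_le (fun _ => abs_nonneg _) (fun i => (hle i).1) hsum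
  · exact Summable.of_nonneg_of_le (fun _ => abs_nonneg _) (fun i => (hle i).2) hsum


end Helpers

/-- any segment barrier for the unit square contained in the concentric
homothetic square [−1/2, 3/2]² has total length at least 2 + 10⁻¹². -/
theorem local_barrier_length_lower_bound
    (a b : ℕ → Pt) (hab : ∀ i, a i ≠ b i)
    (hbar : IsBarrier (⋃ i, segment ℝ (a i) (b i)) unitSquare)
    (hloc : (⋃ i, segment ℝ (a i) (b i)) ⊆
      {p : Pt | p 0 ∈ Icc (-(1/2) : ℝ) (3/2) ∧ p 1 ∈ Icc (-(1/2) : ℝ) (3/2)})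
    (hsum : Summable fun i => ‖b i - a i‖) :
    2 + 10 ^ (-12 : ℤ) ≤ ∑' i, ‖b i - a i‖ := by
  by_contra hlt
  rw [not_le] at hlt
  have C := mkCfg a b hbar hloc hsum
  have he : (fun i => Real.sqrt ((b i 0 - a i 0) ^ 2 + (b i 1 - a i 1) ^ 2)) =
      fun i => ‖b i - a i‖ := by
    ext i
    rw [len_eq]; rfl
  refine (C.tight (by rw [he]; exact hsum) ?_).contra_small le_rfl
  rw [he]
  refine hlt.trans_le ?_
  norm_num
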